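/- arXiv:1112.2161 — 4 statements merged into one kernel-verified Lean document; each statement's English description precedes it below -/
import Mathlib

section
/- Let k be an algebraically closed field of prime characteristic p, let I be a prime ideal of the polynomial ring k[x_1, …, x_n], and set A = k[x_1, …, x_n]/I. Suppose the domain A is strongly F-regular. Then a general hyperplane section of Spec A is strongly F-regular: there exists a nonzero polynomial g ∈ k[T_0, T_1, …, T_n] such that for every (c_0, c_1, …, c_n) ∈ k^{n+1} with g(c_0, …, c_n) ≠ 0, the ring B = A/(c_0 + c_1 x_1 + ⋯ + c_n x_n) is strongly F-regular, i.e. B is reduced and for every c ∈ B not contained in any minimal prime of B there exist e ≥ 1 and an additive map φ : B → B with φ(r^{p^e} x) = r φ(x) for all r, x ∈ B and φ(c) = 1. -/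
/-- The coordinate ring of the scheme-theoretic intersection of
`Spec (k[x₁,…,xₙ]/I) ⊆ 𝔸ⁿ_k` with the affine hyperplane `c₀ + c₁x₁ + ⋯ + cₙxₙ = 0`. -/
abbrev HyperplaneSection (k : Type*) [Field k] (n : ℕ)
    (I : Ideal (MvPolynomial (Fin n) k)) (c : Fin (n + 1) → k) : Type _ :=
  (MvPolynomial (Fin n) k ⧸ I) ⧸
    Ideal.span {Ideal.Quotient.mk I
      (MvPolynomial.C (c 0) + ∑ i : Fin n, MvPolynomial.C (c i.succ) * MvPolynomial.X i)}

universe u v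

theorem exists_smul_eq_linearCombination_linearIndepOn {R M ι : Type*} [CommRing R] [IsDomain R]
    [AddCommGroup M] [Module R M] [Finite ι] (v : ι → M) (hv : Submodule.span R (Set.range v) = ⊤) :
    ∃ S : Set ι, LinearIndepOn R v S ∧ ∃ s : R, s ≠ 0 ∧ ∃ Φ : M →ₗ[R] (S →₀ R),
      ∀ z, s • z = Finsupp.linearCombination R (fun i : S => v i) (Φ z) := by
  classical
  have := Fintype.ofFinite ι
  obtain ⟨S, hS, hmax⟩ := exists_maximal_linearIndepOn R v
  have key : ∀ i, ∃ a : R, a ≠ 0 ∧ a • v i ∈ Submodule.span R (v '' S) := fun i => by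
    by_cases hi : i ∈ S
    · exact ⟨1, one_ne_zero, by
        rw [one_smul]; exact Submodule.subset_span (Set.mem_image_of_mem v hi)⟩
    · exact hmax i hi
  choose a ha0 ha using key
  have hspan : ∀ z : M, (∏ i, a i) • z ∈ Submodule.span R (Set.range fun i : S => v i) := by
    intro z
    have hz : z ∈ Submodule.span R (Set.range v) := hv ▸ Submodule.mem_top
    have himg : (Set.range fun i : S => v i) = v '' S := by
      ext y; simp
    rw [himg]
    induction hz using Submodule.span_induction with
    | mem x hx =>
      obtain ⟨i, rfl⟩ := hx
      rw [← Finset.prod_erase_mul _ _ (Finset.mem_univ i), mul_smul]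
      exact Submodule.smul_mem _ _ (ha i)
    | zero => simp
    | add x y _ _ hx hy => rw [smul_add]; exact add_mem hx hy
    | smul r x _ hx => rw [smul_comm]; exact Submodule.smul_mem _ _ hx
  have hli : LinearIndependent R fun i : S => v i := hS
  refine ⟨S, hS, ∏ i, a i, Finset.prod_ne_zero_iff.2 fun i _ => ha0 i,
    hli.repr ∘ₗ
      LinearMap.codRestrict _ ((∏ i, a i) • LinearMap.id) (fun z => hspan z), fun z => ?_⟩
  simp [hli.linearCombination_repr]

theorem RingHom.Finite.exists_coordinates {R M : Type*} [CommRing R] [IsDomain R] [CommRing M]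
    {F : R →+* M} (hF : F.Finite) :
    ∃ (m : ℕ) (S : Set (Fin m)) (_ : Fintype S) (u : S → M),
      (∀ r : S → R, ∑ i, F (r i) * u i = 0 → r = 0) ∧
      ∃ s : R, s ≠ 0 ∧ ∃ Φ : S → (M →+ R), (∀ i r x, Φ i (F r * x) = r * Φ i x) ∧
        ∀ z, F s * z = ∑ i, F (Φ i z) * u i := by
  classical
  algebraize [F]
  obtain ⟨m, v, hv⟩ := Module.Finite.exists_fin (R := R) (M := M)
  obtain ⟨S, hS, s, hs, Φ, hΦ⟩ := exists_smul_eq_linearCombination_linearIndepOn v hv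
  refine ⟨m, S, inferInstance, fun i => v i, fun r hr => ?_, s, hs,
    fun i => ((Finsupp.lapply i).comp Φ).toAddMonoidHom, fun i r x => ?_, fun z => ?_⟩
  · have := Fintype.linearIndependent_iff.1 (show LinearIndependent R fun i : S => v i from hS) r
    funext i
    refine this ?_ i
    simpa [Algebra.smul_def, RingHom.algebraMap_toAlgebra] using hr
  · have : F r * x = r • x := by rw [Algebra.smul_def]; rfl
    simp [this]
  · have : F s * z = s • z := by rw [Algebra.smul_def]; rfl
    rw [this, hΦ, Finsupp.linearCombination_apply, Finsupp.sum_fintype _ _ (by simp)]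
    simp [Algebra.smul_def, RingHom.algebraMap_toAlgebra]

/-- An additive map `φ : R → R` is `p⁻ᵉ`-linear if `φ (r ^ p ^ e * x) = r * φ x`, i.e. if it is an
`R`-linear map `F^e_* R → R`. -/
def IsCartierLinear {R : Type*} [CommRing R] (p e : ℕ) (φ : R →+ R) : Prop :=
  ∀ r x, φ (r ^ p ^ e * x) = r * φ x

namespace IsCartierLinear

variable {R : Type*} [CommRing R] {p e e' : ℕ} {φ ψ : R →+ R}

theorem comp (hφ : IsCartierLinear p e φ) (hψ : IsCartierLinear p e' ψ) :
    IsCartierLinear p (e + e') (φ.comp ψ) := fun r x => by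
  simp only [AddMonoidHom.comp_apply]
  rw [pow_add, pow_mul, hψ, hφ]

theorem comp_mulLeft (hφ : IsCartierLinear p e φ) (a : R) :
    IsCartierLinear p e (φ.comp (AddMonoidHom.mulLeft a)) := fun r x => by
  simp only [AddMonoidHom.comp_apply, AddMonoidHom.coe_mulLeft]
  rw [mul_left_comm, hφ]

theorem id : IsCartierLinear p 0 (AddMonoidHom.id R) := fun r x => by simp

theorem add (hφ : IsCartierLinear p e φ) (hψ : IsCartierLinear p e ψ) :
    IsCartierLinear p e (φ + ψ) := fun r x => by
  simp [hφ r x, hψ r x, mul_add]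

theorem mulLeft_comp (hφ : IsCartierLinear p e φ) (a : R) :
    IsCartierLinear p e ((AddMonoidHom.mulLeft a).comp φ) := fun r x => by
  simp [hφ r x, mul_left_comm]

theorem eq_zero_of_mul [IsDomain R] (hp : p.Prime) (hφ : IsCartierLinear p e φ) {y : R}
    (hy : y ≠ 0) (h : ∀ z, φ (y * z) = 0) (z : R) : φ z = 0 := by
  have h1 := hφ y z
  have hpe : p ^ e ≠ 0 := (pow_pos hp.pos e).ne'
  rw [← Nat.succ_pred_eq_of_ne_zero hpe, pow_succ', mul_assoc, h] at h1
  exact (mul_eq_zero.1 h1.symm).resolve_left hy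

/-- Over an `F`-finite domain, the `p⁻ᵉ`-linear maps have rank one: each of them is, up to a
nonzero denominator, obtained from a given nonzero one by premultiplication. -/
theorem exists_mul_eq [IsDomain R] (hp : p.Prime) [CharP R p]
    (hF : have := Fact.mk hp; (iterateFrobenius R p e).Finite)
    (hψ : IsCartierLinear p e ψ) (hψ0 : ∃ z, ψ z ≠ 0) (hφ : IsCartierLinear p e φ) :
    ∃ s β : R, s ≠ 0 ∧ ∀ z, s * φ z = ψ (β * z) := by
  have := Fact.mk hp
  obtain ⟨m, S, _, u, hu, s, hs, Φ, hΦ, hz⟩ := hF.exists_coordinates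
  simp only [iterateFrobenius_def] at hu hΦ hz
  have hdep : ¬ LinearIndependent R (fun o : Option S => fun i : S =>
      o.elim (φ (u i)) (fun j => ψ (u j * u i))) := fun h => by
    have := h.fintype_card_le_finrank
    simp at this
  rw [Fintype.not_linearIndependent_iff] at hdep
  obtain ⟨c, hc, o, ho⟩ := hdep
  have hc' : ∀ i, c none * φ (u i) + ∑ j, c (some j) * ψ (u j * u i) = 0 := fun i => by
    simpa [Fintype.sum_option] using congrFun hc i
  set β : R := ∑ j, c (some j) ^ p ^ e * u j with hβ
  have hψβ : ∀ x, ψ (β * x) = ∑ j, c (some j) * ψ (u j * x) := fun x => by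
    rw [hβ, Finset.sum_mul, map_sum]
    exact Finset.sum_congr rfl fun j _ => by rw [mul_assoc, hψ]
  have hall : ∀ z, c none * φ z + ψ (β * z) = 0 := fun z => by
    have hs' : s * (c none * φ z + ψ (β * z)) = 0 := by
      calc s * (c none * φ z + ψ (β * z))
          = c none * φ (s ^ p ^ e * z) + ψ (β * (s ^ p ^ e * z)) := by
            rw [hφ, mul_left_comm β, hψ]; ring
        _ = ∑ i, Φ i z * (c none * φ (u i) + ψ (β * u i)) := by
            simp only [hz, Finset.mul_sum, map_sum, mul_add, Finset.sum_add_distrib]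
            congr 1 <;> refine Finset.sum_congr rfl fun i _ => ?_
            · rw [hφ]; ring
            · rw [mul_left_comm β, hψ]
        _ = 0 := Finset.sum_eq_zero fun i _ => by rw [hψβ, hc', mul_zero]
    exact (mul_eq_zero.1 hs').resolve_left hs
  refine ⟨c none, -β, fun h0 => ?_, fun z => ?_⟩
  · have hβ0 : β = 0 := by
      by_contra hβ0
      obtain ⟨z, hz0⟩ := hψ0
      exact hz0 (hψ.eq_zero_of_mul hp hβ0 (fun z => by simpa [h0] using hall z) z)
    have := hu (fun j => c (some j)) hβ0
    rcases o with _ | j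
    · exact ho h0
    · exact ho (congrFun this j)
  · rw [neg_mul, map_neg]
    exact eq_neg_of_add_eq_zero_left (hall z)

end IsCartierLinear

theorem Ideal.exists_mul_mem_of_forall_mul_mem_sup_mul {R : Type*} [CommRing R] [IsNoetherianRing R]
    {P : Ideal R} [P.IsPrime] {N J : Ideal R} {u : R} (hu : u ∉ P)
    (h : ∀ x ∈ N, u * x ∈ J ⊔ P * N) {x : R} (hx : x ∈ N) : ∃ s ∉ P, s * x ∈ J := by
  let L := Localization.AtPrime P
  have hu' : IsUnit (algebraMap R L u) := IsLocalization.map_units L (⟨u, hu⟩ : P.primeCompl)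
  have hle : N.map (algebraMap R L) ≤ J.map (algebraMap R L) := by
    refine Submodule.le_of_le_smul_of_le_jacobson_bot (I := IsLocalRing.maximalIdeal L)
      (IsNoetherian.noetherian _) (IsLocalRing.maximalIdeal_le_jacobson _) ?_
    rw [Ideal.map_le_iff_le_comap]
    intro y hy
    have h1 := Ideal.mem_map_of_mem (algebraMap R L) (h y hy)
    rw [map_mul, Ideal.unit_mul_mem_iff_mem _ hu', Ideal.map_sup, Ideal.map_mul,
      Localization.AtPrime.map_eq_maximalIdeal] at h1
    exact h1
  obtain ⟨s, hs, h2⟩ := (IsLocalization.algebraMap_mem_map_algebraMap_iff P.primeCompl L J x).1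
    (hle (Ideal.mem_map_of_mem _ hx))
  exact ⟨s, hs, h2⟩

theorem Derivation.exists_iterate_pow_mul_eq {k R : Type*} [CommRing k] [CommRing R] [Algebra k R]
    (D : Derivation k R R) (h : R) (i m : ℕ) (b : R) :
    ∃ c, D^[i] (h ^ (m + i) * b) =
      ((m + i).descFactorial i : R) * D h ^ i * h ^ m * b + h ^ (m + 1) * c := by
  induction i generalizing m with
  | zero => exact ⟨0, by simp⟩
  | succ i ih =>
    obtain ⟨c, hc⟩ := ih (m + 1)
    have e1 : m + (i + 1) = m + 1 + i := by ring
    have e2 : (m + 1 + i).descFactorial (i + 1) = (m + 1) * (m + 1 + i).descFactorial i := by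
      rw [Nat.descFactorial_succ, Nat.add_sub_cancel]
    rw [Function.iterate_succ_apply', e1, hc, e2]
    set K : R := ((m + 1 + i).descFactorial i : R) with hK
    refine ⟨D (K * D h ^ i * b) + (m + 1 + 1) * D h * c + h * D c, ?_⟩
    have e3 : K * D h ^ i * h ^ (m + 1) * b + h ^ (m + 1 + 1) * c =
        h ^ (m + 1) * (K * D h ^ i * b) + h ^ (m + 1 + 1) * c := by ring
    rw [e3, map_add, D.leibniz, D.leibniz (h ^ (m + 1 + 1)), D.leibniz_pow, D.leibniz_pow]
    simp only [smul_eq_mul, nsmul_eq_mul, Nat.add_sub_cancel]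
    push_cast
    rw [← hK]
    ring

theorem Derivation.iterate_mem_map_frobenius {k R : Type*} [CommRing k] [CommRing R] [Algebra k R]
    {p : ℕ} [Fact p.Prime] [CharP R p] (D : Derivation k R R) {N : Ideal R} (i : ℕ) {x : R}
    (hx : x ∈ N.map (frobenius R p)) : D^[i] x ∈ N.map (frobenius R p) := by
  induction i with
  | zero => exact hx
  | succ i ih =>
    rw [Function.iterate_succ_apply']
    generalize D^[i] x = y at ih
    rw [Ideal.map] at ih
    induction ih using Submodule.span_induction with
    | mem y hy =>
      obtain ⟨z, -, rfl⟩ := hy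
      simp [frobenius_def, D.leibniz_pow]
    | zero => simp
    | add y z _ _ hy hz => rw [map_add]; exact add_mem hy hz
    | smul r y h1 hy =>
      rw [smul_eq_mul, D.leibniz]
      exact add_mem (Ideal.mul_mem_left _ _ hy) (Ideal.mul_mem_right _ _ h1)

theorem Derivation.iterate_pow_char_mul {k R : Type*} [CommRing k] [CommRing R] [Algebra k R]
    {p : ℕ} [Fact p.Prime] [CharP R p] (D : Derivation k R R) (i : ℕ) (f x : R) :
    D^[i] (f ^ p * x) = f ^ p * D^[i] x := by
  induction i with
  | zero => rfl
  | succ i ih =>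
    rw [Function.iterate_succ_apply', ih, D.leibniz, D.leibniz_pow, Function.iterate_succ_apply']
    simp

theorem not_mem_of_natCast_factorial_pred {R : Type*} [CommRing R] {p : ℕ} (hp : p.Prime)
    [CharP R p] {P : Ideal R} (hP : P.IsPrime) : (((p - 1).factorial : ℕ) : R) ∉ P := by
  refine fun h => hP.ne_top (Ideal.eq_top_of_isUnit_mem _ h ?_)
  rw [CharP.isUnit_natCast_iff hp, hp.dvd_factorial]
  have := hp.pos
  omega

namespace IsCartierLinear

theorem iterate_mul_eq {R : Type*} [CommRing R] {p : ℕ} (hp : p.Prime) {Φ : R →+ R}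
    (hΦ : IsCartierLinear p 1 Φ) (e : ℕ) :
    ∃ φ : R →+ R, IsCartierLinear p e φ ∧
      ∀ h z, φ (h ^ (p ^ e - 1) * z) = (fun y => Φ (h ^ (p - 1) * y))^[e] z := by
  induction e with
  | zero => exact ⟨_, IsCartierLinear.id, by simp⟩
  | succ e ih =>
    obtain ⟨φ, hφ, h1⟩ := ih
    refine ⟨Φ.comp φ, add_comm e 1 ▸ hΦ.comp hφ, fun h z => ?_⟩
    rw [Function.iterate_succ_apply', ← h1, ← hφ, ← mul_assoc, ← pow_mul, ← pow_add]
    have : (p - 1) * p ^ e + (p ^ e - 1) = p ^ (e + 1) - 1 := by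
      have h2 := hp.one_lt
      have h3 : 1 ≤ p ^ e := Nat.one_le_pow _ _ hp.pos
      obtain ⟨m, rfl⟩ := Nat.exists_eq_add_of_lt h2
      rw [pow_succ']
      generalize (1 + m + 1) ^ e = q at *
      have : 1 + m + 1 - 1 = m + 1 := by omega
      rw [this]
      have h4 : (1 + m + 1) * q = (m + 1) * q + q := by ring
      omega
    rw [this]
    rfl

theorem iterate_not_mem {R : Type*} [CommRing R] {p : ℕ} (hp : p.Prime) {Ψ : R →+ R}
    (hΨ : IsCartierLinear p 1 Ψ) {P : Ideal R} (hP : P.IsPrime) {a : R} (ha : Ψ a ∉ P) (e : ℕ) :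
    ∃ b, Ψ^[e] b ∉ P := by
  induction e with
  | zero => exact ⟨1, fun h => hP.ne_top ((Ideal.eq_top_iff_one _).2 h)⟩
  | succ e ih =>
    obtain ⟨b, hb⟩ := ih
    have hiter : ∀ (e : ℕ) (r z : R), Ψ^[e] (r ^ p ^ e * z) = r * Ψ^[e] z := by
      intro e
      induction e with
      | zero => simp
      | succ e ih =>
        intro r z
        rw [Function.iterate_succ_apply', Function.iterate_succ_apply', pow_succ', pow_mul, ih]
        simpa using hΨ r (Ψ^[e] z)
    set w := Ψ^[e] b
    refine ⟨(w ^ (p - 1) * a) ^ p ^ e * b, ?_⟩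
    rw [Function.iterate_succ_apply', hiter]
    have : w ^ (p - 1) * a * w = w ^ p ^ 1 * a := by
      rw [pow_one, mul_right_comm, pow_sub_one_mul hp.ne_zero]
    rw [this, hΨ]
    exact fun h => (hP.mem_or_mem h).elim hb ha

/-- Over an `F`-finite domain there is a single `p⁻¹`-linear map that, away from a hypersurface,
detects membership in Frobenius powers of ideals. -/
theorem exists_generator {R : Type*} [CommRing R] [IsDomain R] {p : ℕ} [Fact p.Prime]
    [CharP R p] (hF : (frobenius R p).Finite) :
    ∃ (Φ : R →+ R) (f : R), IsCartierLinear p 1 Φ ∧ f ≠ 0 ∧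
      ∀ (N : Ideal R) (z : R), (∀ a, Φ (z * a) ∈ N) → f * z ∈ N.map (frobenius R p) := by
  have hp := Fact.out (p := p.Prime)
  obtain ⟨m, S, _, u, hu, s, hs, Φ, hΦ, hz⟩ := hF.exists_coordinates
  have hΦ' : ∀ i, IsCartierLinear p 1 (Φ i) := fun i r x => by
    simpa [frobenius_def] using hΦ i r x
  have hne : ∃ i z, Φ i z ≠ 0 := by
    by_contra! hcon
    have := hz 1
    simp [hcon, frobenius_def, hs, hp.ne_zero] at this
  obtain ⟨i, z, hiz⟩ := hne
  have hmul : ∀ j, ∃ s β : R, s ≠ 0 ∧ ∀ z, s * Φ j z = Φ i (β * z) := fun j =>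
    (hΦ' i).exists_mul_eq hp (by simpa [iterateFrobenius_one] using hF) ⟨z, hiz⟩ (hΦ' j)
  choose t β ht hβ using hmul
  classical
  refine ⟨Φ i, frobenius R p (s * ∏ j, t j), hΦ' i, ?_, fun N z hN => ?_⟩
  · simp [frobenius_def, hs, Finset.prod_ne_zero_iff, ht]
  · have : frobenius R p (s * ∏ j, t j) * z =
        ∑ j, frobenius R p ((∏ j, t j) * Φ j z) * u j := by
      rw [map_mul, mul_right_comm, hz, Finset.sum_mul]
      exact Finset.sum_congr rfl fun j _ => by rw [map_mul]; ring
    rw [this]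
    refine Ideal.sum_mem _ fun j _ => Ideal.mul_mem_right _ _ (Ideal.mem_map_of_mem _ ?_)
    rw [← Finset.prod_erase_mul _ _ (Finset.mem_univ j), mul_assoc, hβ, mul_comm (β j)]
    exact Ideal.mul_mem_left _ _ (hN _)

theorem exists_mul_mem_span_of_iterate_mem {k R : Type*} [CommRing k] [CommRing R] [Algebra k R]
    [IsNoetherianRing R] {p : ℕ} [Fact p.Prime] [CharP R p] {Φ : R →+ R}
    (hΦ : IsCartierLinear p 1 Φ) {f : R}
    (hgen : ∀ (N : Ideal R) (z : R), (∀ a, Φ (z * a) ∈ N) → f * z ∈ N.map (frobenius R p))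
    {P : Ideal R} (hP : P.IsPrime) (hf : f ∉ P) {h : R} (hh : h ∈ P)
    (D : Derivation k R R) (hD : D h ∉ P) {b : R}
    (hb : ∀ e, 1 ≤ e → ∀ a, (fun y => Φ (h ^ (p - 1) * y))^[e] (b * a) ∈ P) :
    ∃ s ∉ P, s * b ∈ Ideal.span {h} := by
  have hp := Fact.out (p := p.Prime)
  set Ψ : R → R := fun y => Φ (h ^ (p - 1) * y) with hΨ
  have hadd : ∀ e x y, Ψ^[e] (x + y) = Ψ^[e] x + Ψ^[e] y := by
    intro e
    induction e with
    | zero => simp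
    | succ e ih =>
      intro x y
      simp only [Function.iterate_succ_apply', ih]
      simp [hΨ, mul_add]
  have hzero : ∀ e, Ψ^[e] 0 = 0 := fun e => by simpa using hadd e 0 0
  let N : Ideal R :=
    { carrier := {x | ∀ e, 1 ≤ e → ∀ a, Ψ^[e] (x * a) ∈ P}
      add_mem' := fun hx hy e he a => by
        rw [add_mul, hadd]; exact add_mem (hx e he a) (hy e he a)
      zero_mem' := fun e he a => by rw [zero_mul, hzero]; exact P.zero_mem
      smul_mem' := fun r x hx e he a => by
        rw [smul_eq_mul, mul_comm r, mul_assoc]; exact hx e he _ }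
  set u : R := f ^ p * ((p - 1).factorial : R) * D h ^ (p - 1) with hu
  have huP : u ∉ P := by
    intro h1
    rcases hP.mem_or_mem h1 with h1 | h1
    · rcases hP.mem_or_mem h1 with h1 | h1
      · exact hf (hP.mem_of_pow_mem _ h1)
      · exact not_mem_of_natCast_factorial_pred hp hP h1
    · exact hD (hP.mem_of_pow_mem _ h1)
  have key : ∀ (M : Ideal R) (x : R), (∀ a, Ψ (x * a) ∈ M) →
      u * x ∈ Ideal.span {h} ⊔ M.map (frobenius R p) := by
    intro M x hx
    have h1 : f * (h ^ (p - 1) * x) ∈ M.map (frobenius R p) :=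
      hgen M _ fun a => by rw [mul_assoc]; exact hx a
    have h2 : f ^ p * (h ^ (p - 1) * x) ∈ M.map (frobenius R p) := by
      rw [← pow_sub_one_mul hp.ne_zero f, mul_assoc]
      exact Ideal.mul_mem_left _ _ h1
    have h3 := D.iterate_mem_map_frobenius (p - 1) h2
    obtain ⟨c, hc⟩ := D.exists_iterate_pow_mul_eq h (p - 1) 0 x
    simp only [zero_add, pow_zero, mul_one, pow_one, Nat.descFactorial_self] at hc
    rw [D.iterate_pow_char_mul, hc, mul_add] at h3
    have h4 : u * x = -(h * (f ^ p * c)) + (f ^ p * (((p - 1).factorial : R) * D h ^ (p - 1) * x) +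
        f ^ p * (h * c)) := by rw [hu]; ring
    rw [h4]
    exact Submodule.add_mem_sup (neg_mem (Ideal.mul_mem_right _ _
      (Ideal.mem_span_singleton_self h))) h3
  have hNP : N ≤ P := fun x hx => by
    have h1 := key P x fun a => hx 1 le_rfl a
    have h2 : Ideal.span {h} ⊔ P.map (frobenius R p) ≤ P := by
      refine sup_le ((Ideal.span_singleton_le_iff_mem _).2 hh) ?_
      rw [Ideal.map_le_iff_le_comap]
      exact fun y hy => Ideal.pow_mem_of_mem _ hy _ hp.pos
    exact (hP.mem_or_mem (h2 h1)).resolve_left huP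
  refine Ideal.exists_mul_mem_of_forall_mul_mem_sup_mul (N := N) huP (fun x hx => ?_) hb
  have h1 := key N x fun a e he a' => by
    have h2 := hx (e + 1) (by omega) (a * a' ^ p)
    rw [Function.iterate_succ_apply] at h2
    have h3 : Ψ (x * (a * a' ^ p)) = Ψ (x * a) * a' := by
      have := hΦ a' (h ^ (p - 1) * (x * a))
      rw [pow_one] at this
      simp only [hΨ]
      rw [mul_comm _ a', ← this]
      ring_nf
    rwa [h3] at h2
  refine (sup_le_sup_left (?_ : N.map (frobenius R p) ≤ P * N) _ :) h1
  rw [Ideal.map_le_iff_le_comap]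
  intro y hy
  rw [Ideal.mem_comap, frobenius_def, ← pow_sub_one_mul hp.ne_zero]
  exact Ideal.mul_mem_mul (Ideal.pow_mem_of_mem _ (hNP hy) _ (Nat.sub_pos_of_lt hp.one_lt)) hy

variable {R : Type*} [CommRing R] {p : ℕ}

theorem exists_of_surjective {S : Type*} [CommRing S] {π : R →+* S} (hπ : Function.Surjective π)
    {e : ℕ} {φ : R →+ R} (hφ : IsCartierLinear p e φ) (hker : ∀ x, π x = 0 → π (φ x) = 0) :
    ∃ ψ : S →+ S, IsCartierLinear p e ψ ∧ ∀ x, ψ (π x) = π (φ x) := by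
  let ψ : S →+ S := AddMonoidHom.liftOfSurjective π.toAddMonoidHom hπ
    ⟨π.toAddMonoidHom.comp φ, fun x hx => hker x hx⟩
  have hψ : ∀ x, ψ (π x) = π (φ x) := fun x =>
    AddMonoidHom.liftOfRightInverse_comp_apply π.toAddMonoidHom _ _
      ⟨π.toAddMonoidHom.comp φ, fun x hx => hker x hx⟩ x
  refine ⟨ψ, fun r x => ?_, hψ⟩
  obtain ⟨r, rfl⟩ := hπ r
  obtain ⟨x, rfl⟩ := hπ x
  rw [← map_pow, ← map_mul, hψ, hφ, hψ, map_mul]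

theorem exists_quotient_span_singleton (hp : p.Prime) (h : R) {e : ℕ} {φ : R →+ R}
    (hφ : IsCartierLinear p e φ) :
    ∃ ψ : (R ⧸ Ideal.span {h}) →+ (R ⧸ Ideal.span {h}), IsCartierLinear p e ψ ∧
      ∀ x, ψ (Ideal.Quotient.mk _ x) = Ideal.Quotient.mk _ (φ (h ^ (p ^ e - 1) * x)) := by
  refine (hφ.comp_mulLeft (h ^ (p ^ e - 1))).exists_of_surjective Ideal.Quotient.mk_surjective
    fun x hx => ?_
  rw [Ideal.Quotient.eq_zero_iff_mem, Ideal.mem_span_singleton'] at hx ⊢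
  obtain ⟨a, rfl⟩ := hx
  refine ⟨φ a, ?_⟩
  simp only [AddMonoidHom.comp_apply, AddMonoidHom.coe_mulLeft]
  rw [mul_comm a h, ← mul_assoc, pow_sub_one_mul (pow_pos hp.pos e).ne', hφ, mul_comm]

theorem exists_eq_pow {e : ℕ} {φ : R →+ R} (hp : p.Prime) (hφ : IsCartierLinear p e φ) (b : R)
    (j : ℕ) : ∃ ψ : R →+ R, IsCartierLinear p ((j + 1) * e) ψ ∧ ψ b = φ b ^ (j + 1) := by
  induction j with
  | zero => exact ⟨φ, by simpa using hφ, by simp⟩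
  | succ j ih =>
    obtain ⟨ψ, hψ, hb⟩ := ih
    set w := φ b
    set y : R := b * w ^ ((j + 1) * (p ^ e - 1))
    refine ⟨φ.comp (ψ.comp (AddMonoidHom.mulLeft (y ^ p ^ ((j + 1) * e)))), ?_, ?_⟩
    · have := hφ.comp (hψ.comp_mulLeft (y ^ p ^ ((j + 1) * e)))
      rwa [show (j + 1 + 1) * e = e + (j + 1) * e by ring]
    · simp only [AddMonoidHom.comp_apply, AddMonoidHom.coe_mulLeft]
      rw [hψ, hb]
      have : y * w ^ (j + 1) = (w ^ (j + 1)) ^ p ^ e * b := by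
        have h1 := Nat.sub_add_cancel (Nat.one_le_pow e p hp.pos)
        rw [← pow_mul]
        conv_rhs => rw [← h1, mul_add, pow_add, mul_one]
        simp only [y]; ring
      rw [this, hφ]
      ring

/-- If the values at `b` of the `p⁻ᵉ`-linear maps, for varying `e ≥ 1`, generate the unit ideal
locally, then a single such map takes the value `1` at `b`. -/
theorem exists_eq_one_of_forall_isPrime (hp : p.Prime) {b : R}
    (h : ∀ P : Ideal R, P.IsPrime → ∃ e, 1 ≤ e ∧ ∃ φ : R →+ R, IsCartierLinear p e φ ∧ φ b ∉ P) :
    ∃ e, 1 ≤ e ∧ ∃ φ : R →+ R, IsCartierLinear p e φ ∧ φ b = 1 := by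
  let I : ℕ → Ideal R := fun e =>
    { carrier := {y | ∃ φ : R →+ R, IsCartierLinear p e φ ∧ φ b = y}
      add_mem' := by
        rintro _ _ ⟨φ, hφ, rfl⟩ ⟨ψ, hψ, rfl⟩
        exact ⟨φ + ψ, hφ.add hψ, rfl⟩
      zero_mem' := ⟨0, fun r x => by simp, rfl⟩
      smul_mem' := by
        rintro r _ ⟨φ, hφ, rfl⟩
        exact ⟨_, hφ.mulLeft_comp r, rfl⟩ }
  have hdvd : ∀ e e', e' ≠ 0 → e ∣ e' → I e ≤ (I e').radical := by
    rintro e _ he ⟨j, rfl⟩ _ ⟨φ, hφ, rfl⟩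
    obtain ⟨j, rfl⟩ := Nat.exists_eq_succ_of_ne_zero (right_ne_zero_of_mul he)
    obtain ⟨ψ, hψ, hb⟩ := hφ.exists_eq_pow hp b j
    exact ⟨j + 1, ψ, mul_comm e (j + 1) ▸ hψ, hb⟩
  let J : ℕ → Ideal R := fun m => (I m.factorial).radical
  have hmono : Monotone J := fun m m' hmm => by
    have := Ideal.radical_mono (hdvd _ _ (Nat.factorial_ne_zero m') (Nat.factorial_dvd_factorial hmm))
    rwa [Ideal.radical_idem] at this
  have htop : (⨆ m, J m) = ⊤ := by
    by_contra hne
    obtain ⟨M, hM, hle⟩ := Ideal.exists_le_maximal _ hne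
    obtain ⟨e, he, φ, hφ, hb⟩ := h M hM.isPrime
    exact hb (hle ((le_iSup J e) (hdvd e _ (Nat.factorial_ne_zero e)
      (Nat.dvd_factorial he le_rfl) ⟨φ, hφ, rfl⟩)))
  have h1 : (1 : R) ∈ ⨆ m, J m := htop ▸ Submodule.mem_top
  obtain ⟨m, n, hm⟩ := (Submodule.mem_iSup_of_directed J hmono.directed_le).1 h1
  rw [one_pow] at hm
  obtain ⟨φ, hφ, hb⟩ := hm
  exact ⟨m.factorial, Nat.succ_le_of_lt (Nat.factorial_pos m), φ, hφ, hb⟩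

theorem exists_pow_mul_eq_one (hp : p.Prime) {e : ℕ} {φ : R →+ R} (hφ : IsCartierLinear p e φ)
    {f : R} (hf : φ f = 1) (m : ℕ) :
    ∃ (e' : ℕ) (ψ : R →+ R) (a : R), IsCartierLinear p e' ψ ∧ ψ (f ^ m * a) = 1 := by
  induction m with
  | zero => exact ⟨e, φ, f, hφ, by simpa using hf⟩
  | succ m ih =>
    obtain ⟨e', ψ, a, hψ, h1⟩ := ih
    refine ⟨e' + e, ψ.comp φ, f ^ (m * (p ^ e - 1)) * a ^ p ^ e, hψ.comp hφ, ?_⟩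
    have : f ^ (m + 1) * (f ^ (m * (p ^ e - 1)) * a ^ p ^ e) = (f ^ m * a) ^ p ^ e * f := by
      have h2 := Nat.sub_add_cancel (Nat.one_le_pow e p hp.pos)
      rw [mul_pow, ← pow_mul]
      conv_rhs => rw [← h2, mul_add, pow_add, mul_one, h2]
      ring
    rw [AddMonoidHom.comp_apply, this, hφ, hf, mul_one, h1]

/-- A test element criterion: if some `p⁻ᵉ`-linear map sends `f` to `1`, then it suffices to
check away from `f` that the values at `b` generate the unit ideal. -/
theorem exists_eq_one_of_forall_not_mem (hp : p.Prime) {b f : R}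
    (hf : ∃ e, 1 ≤ e ∧ ∃ φ : R →+ R, IsCartierLinear p e φ ∧ φ f = 1)
    (h : ∀ P : Ideal R, P.IsPrime → f ∉ P →
      ∃ e, 1 ≤ e ∧ ∃ φ : R →+ R, IsCartierLinear p e φ ∧ φ b ∉ P) :
    ∃ e, 1 ≤ e ∧ ∃ φ : R →+ R, IsCartierLinear p e φ ∧ φ b = 1 := by
  refine exists_eq_one_of_forall_isPrime hp fun P hP => ?_
  by_contra! hcon
  let N : Ideal R :=
    { carrier := {y | ∀ (e : ℕ) (φ : R →+ R), IsCartierLinear p e φ → φ y ∈ P}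
      add_mem' := fun hx hy e φ hφ => by
        rw [map_add]; exact add_mem (hx e φ hφ) (hy e φ hφ)
      zero_mem' := fun e φ hφ => by rw [map_zero]; exact P.zero_mem
      smul_mem' := fun r x hx e φ hφ => hx e _ (hφ.comp_mulLeft r) }
  have hfN : f ∈ N.radical := by
    rw [Ideal.radical_eq_sInf, Ideal.mem_sInf]
    rintro Q ⟨hNQ, hQ⟩
    by_contra hfQ
    obtain ⟨e, he, φ, hφ, hb⟩ := h Q hQ hfQ
    exact hb (hNQ fun e' ψ hψ => hcon (e' + e) (by omega) (ψ.comp φ) (hψ.comp hφ))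
  obtain ⟨m, hm⟩ := hfN
  obtain ⟨e, he, φ, hφ, h1⟩ := hf
  obtain ⟨e', ψ, a, hψ, h2⟩ := exists_pow_mul_eq_one hp hφ h1 m
  have h3 := hm e' _ (hψ.comp_mulLeft a)
  simp only [AddMonoidHom.comp_apply, AddMonoidHom.coe_mulLeft] at h3
  rw [mul_comm, h2] at h3
  exact hP.ne_top ((Ideal.eq_top_iff_one _).2 h3)

/-- If some `p⁻ᵉ`-linear map does not send `c` into `Q`, then there is one of the form
`ψ (c * a * ·)` that induces a nonzero map on `R ⧸ Q`. -/
theorem exists_compatible [IsNoetherianRing R] {Q : Ideal R}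
    {e : ℕ} {c : R} {φ : R →+ R} (hφ : IsCartierLinear p e φ) (hc : φ c ∉ Q) :
    ∃ (a : R) (ψ : R →+ R), IsCartierLinear p e ψ ∧ (∀ x ∈ Q, ψ (c * a * x) ∈ Q) ∧
      ψ (c * a) ∉ Q := by
  let I : Ideal R :=
    { carrier := {y | ∀ ψ : R →+ R, IsCartierLinear p e ψ → ψ y ∈ Q}
      add_mem' := fun hx hy φ hφ => by
        rw [map_add]; exact add_mem (hx φ hφ) (hy φ hφ)
      zero_mem' := fun φ hφ => by rw [map_zero]; exact Q.zero_mem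
      smul_mem' := fun r x hx φ hφ => hx _ (hφ.comp_mulLeft r) }
  obtain ⟨K, ⟨a, haI, rfl⟩, hmax⟩ := set_has_maximal_iff_noetherian.mpr ‹IsNoetherianRing R›
    {K : Ideal R | ∃ a, c * a ∉ I ∧ K = I.colon {c * a}}
    ⟨_, 1, fun h => hc (by simpa using h φ hφ), rfl⟩
  have hmem : ∀ {y x : R}, x ∈ I.colon {y} ↔ x * y ∈ I := Submodule.mem_colon_singleton
  have hQI : ∀ x ∈ Q, x * (c * a) ∈ I := by
    intro x hx
    by_contra hxI
    have hex : ∃ k, x ^ k * (c * a) ∈ I := ⟨p ^ e, fun ψ hψ => by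
      rw [hψ]; exact Ideal.mul_mem_right _ _ hx⟩
    classical
    obtain ⟨k, hk⟩ : ∃ k, Nat.find hex = k + 1 := Nat.exists_eq_succ_of_ne_zero fun h0 =>
      haI (by simpa [h0] using Nat.find_spec hex)
    have h1 : x ^ k * (c * a) ∉ I := Nat.find_min hex (by omega)
    have h2 : x ^ (k + 1) * (c * a) ∈ I := hk ▸ Nat.find_spec hex
    refine hmax (I.colon {c * (x ^ k * a)}) ⟨_, by rwa [mul_left_comm], rfl⟩
      (lt_of_le_of_ne (fun z hz => ?_) fun heq => ?_)
    · rw [hmem] at hz ⊢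
      have := I.mul_mem_left (x ^ k) hz
      convert this using 1
      ring
    · apply hxI
      rw [← hmem, heq, hmem]
      convert h2 using 1
      ring
  have : ∃ ψ : R →+ R, IsCartierLinear p e ψ ∧ ψ (c * a) ∉ Q := by
    by_contra! hcon
    exact haI hcon
  obtain ⟨ψ, hψ, h1⟩ := this
  exact ⟨a, ψ, hψ, fun x hx => by rw [mul_comm]; exact hQI x hx ψ hψ, h1⟩

end IsCartierLinear

open scoped KaehlerDifferential Cardinal in
theorem Algebra.trdeg_le_of_smul_kaehlerDifferential_mem_span {k D : Type*} [Field k] [CommRing D]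
    [IsDomain D] [Algebra k D] [Algebra.FiniteType k D] (S : Set D) {s : D} (hs : s ≠ 0)
    (h : ∀ z : Ω[D⁄k], s • z ∈ Submodule.span D (KaehlerDifferential.D k D '' S)) :
    Algebra.trdeg k D ≤ #S := by
  let L := FractionRing D
  let K := IntermediateField.adjoin k (algebraMap D L '' S)
  have : Algebra.EssFiniteType D L := .of_isLocalization _ (nonZeroDivisors D)
  have : Algebra.EssFiniteType k L := .comp k D L
  have : Algebra.EssFiniteType K L := .of_comp k K L
  let l := KaehlerDifferential.map k K D L
  have hl : ∀ z, l z = 0 := fun z => by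
    have h1 : Submodule.span D (KaehlerDifferential.D k D '' S) ≤ LinearMap.ker l := by
      rw [Submodule.span_le]
      rintro _ ⟨x, hx, rfl⟩
      have hxK : algebraMap D L x ∈ K :=
        IntermediateField.subset_adjoin k _ (Set.mem_image_of_mem _ hx)
      change l _ = 0
      rw [KaehlerDifferential.map_D]
      exact (KaehlerDifferential.D K L).map_algebraMap ⟨_, hxK⟩
    have h2 : s • l z = 0 := by rw [← map_smul]; exact h1 (h z)
    rw [← algebraMap_smul L s (l z)] at h2
    exact (smul_eq_zero.1 h2).resolve_left
      ((map_ne_zero_iff _ (IsFractionRing.injective D L)).2 hs)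
  have hD : ∀ d : D, KaehlerDifferential.D K L (algebraMap D L d) = 0 := fun d => by
    rw [← KaehlerDifferential.map_D k K D L]; exact hl _
  have hzero : ∀ y : L, KaehlerDifferential.D K L y = 0 := fun y => by
    obtain ⟨a, b, hb, rfl⟩ := IsFractionRing.div_surjective (A := D) y
    have hb0 : algebraMap D L b ≠ 0 :=
      (map_ne_zero_iff _ (IsFractionRing.injective D L)).2 (nonZeroDivisors.ne_zero hb)
    have h1 := (KaehlerDifferential.D K L).leibniz (algebraMap D L b)
      (algebraMap D L a / algebraMap D L b)
    rw [mul_div_cancel₀ _ hb0, hD, hD, smul_zero, add_zero] at h1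
    exact (smul_eq_zero.1 h1.symm).resolve_left hb0
  have : Algebra.FormallyUnramified K L := ⟨by
    rw [← Submodule.subsingleton_iff L, ← subsingleton_iff_bot_eq_top,
      ← KaehlerDifferential.span_range_derivation, eq_comm, Submodule.span_eq_bot]
    rintro _ ⟨y, rfl⟩
    exact hzero y⟩
  have : Algebra.IsSeparable K L := Algebra.FormallyUnramified.isSeparable K L
  have : Algebra.IsAlgebraic (Algebra.adjoin k (algebraMap D L '' S)) L := by
    let _ : Algebra (Algebra.adjoin k (algebraMap D L '' S)) K :=
      (Subalgebra.inclusion (IntermediateField.algebra_adjoin_le_adjoin k _)).toAlgebra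
    have : IsScalarTower (Algebra.adjoin k (algebraMap D L '' S)) K L := .of_algebraMap_eq' rfl
    have : IsFractionRing (Algebra.adjoin k (algebraMap D L '' S)) K :=
      open IntermediateField.algebraAdjoinAdjoin in inferInstance
    exact (IsFractionRing.comap_isAlgebraic_iff (K := K)).2 inferInstance
  exact (trdeg_le_of_injective (IsScalarTower.toAlgHom k D L) (IsFractionRing.injective D L)).trans
    ((Algebra.IsAlgebraic.trdeg_le_cardinalMk k (algebraMap D L '' S)).trans
      Cardinal.mk_image_le)

open scoped KaehlerDifferential Cardinal in
/-- A finitely generated domain has, up to a common denominator, at least `trdeg k D` derivations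
dual to a subset of its generators. -/
theorem exists_derivation_apply_eq_ite {k D : Type*} [Field k] [CommRing D] [IsDomain D]
    [Algebra k D] {n : ℕ} {x : Fin n → D} (hx : Algebra.adjoin k (Set.range x) = ⊤) :
    ∃ (S : Set (Fin n)) (s : D) (d : S → Derivation k D D), s ≠ 0 ∧
      (∀ i j : S, d i (x j) = if i = j then s else 0) ∧ Algebra.trdeg k D ≤ Cardinal.lift #S := by
  classical
  have hspan : Submodule.span D (Set.range fun i => KaehlerDifferential.D k D (x i)) = ⊤ := by
    rw [eq_top_iff, ← KaehlerDifferential.span_range_derivation, Submodule.span_le]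
    rintro _ ⟨y, rfl⟩
    have hy : y ∈ Algebra.adjoin k (Set.range x) := hx ▸ Algebra.mem_top
    induction hy using Algebra.adjoin_induction with
    | mem y hy =>
      obtain ⟨i, rfl⟩ := hy
      exact Submodule.subset_span ⟨i, rfl⟩
    | algebraMap r => simp
    | add y z _ _ hy hz => rw [map_add]; exact add_mem hy hz
    | mul y z _ _ hy hz =>
      rw [Derivation.leibniz]
      exact add_mem (Submodule.smul_mem _ _ hz) (Submodule.smul_mem _ _ hy)
  obtain ⟨S, hS, s, hs, Φ, hΦ⟩ := exists_smul_eq_linearCombination_linearIndepOn _ hspan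
  have hli : LinearIndependent D fun i : S => KaehlerDifferential.D k D (x i) := hS
  refine ⟨S, s, fun i => ((Finsupp.lapply i).comp Φ).compDer (KaehlerDifferential.D k D), hs,
    fun i j => ?_, ?_⟩
  · have h1 : Φ (KaehlerDifferential.D k D (x j)) = Finsupp.single j s :=
      hli (by rw [← hΦ]; simp)
    simp [h1, Finsupp.single_apply, eq_comm]
  · have : Algebra.FiniteType k D := ⟨⟨(Set.finite_range x).toFinset, by simpa using hx⟩⟩
    have h1 := Algebra.trdeg_le_of_smul_kaehlerDifferential_mem_span (k := k) (x '' S) hs fun z => by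
      rw [hΦ, Set.image_image]
      rw [Finsupp.linearCombination_apply]
      exact Submodule.sum_mem _ fun i _ => Submodule.smul_mem _ _
        (Submodule.subset_span (Set.mem_image_of_mem _ i.2))
    refine h1.trans ?_
    simpa using Cardinal.mk_image_le_lift (f := x) (s := S)

/-- The affine form `c₀ + c₁x₁ + ⋯ + cₙxₙ`. -/
def affineForm {k D : Type*} [CommRing k] [CommRing D] [Algebra k D] {n : ℕ} (x : Fin n → D)
    (c : Fin (n + 1) → k) : D :=
  algebraMap k D (c 0) + ∑ i, algebraMap k D (c i.succ) * x i

theorem map_affineForm {k D E : Type*} [CommRing k] [CommRing D] [CommRing E] [Algebra k D]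
    [Algebra k E] {n : ℕ} (φ : D →ₐ[k] E) (x : Fin n → D) (c : Fin (n + 1) → k) :
    φ (affineForm x c) = affineForm (φ ∘ x) c := by
  simp [affineForm]

open scoped Cardinal in
/-- On a dense open subset, a general hyperplane section is smooth in the weak sense that some
derivation of the ambient ring does not kill its equation. -/
theorem exists_derivation_hyperplane_not_mem {k : Type u} {D : Type v} [Field k] [CommRing D]
    [IsDomain D] [Algebra k D] {n : ℕ} {x : Fin n → D}
    (hx : Algebra.adjoin k (Set.range x) = ⊤) :
    ∃ f : D, f ≠ 0 ∧ ∃ g : MvPolynomial (Fin (n + 1)) k, g ≠ 0 ∧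
      ∀ c : Fin (n + 1) → k, MvPolynomial.eval c g ≠ 0 → ∀ P : Ideal D, P.IsPrime → f ∉ P →
        affineForm x c ∈ P → ∃ d : Derivation k D D, d (affineForm x c) ∉ P := by
  classical
  obtain ⟨S, s, d, hs, hd, htr⟩ := exists_derivation_apply_eq_ite hx
  let M := MvPolynomial {i // i ∉ S} D
  let σ : Fin n → M := fun i => if h : i ∈ S then
    -∑ j : {i // i ∉ S}, MvPolynomial.C (d ⟨i, h⟩ (x j)) * MvPolynomial.X j
    else MvPolynomial.C s * MvPolynomial.X ⟨i, h⟩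
  let τ : Fin (n + 1) → M := Fin.cons (-∑ i, σ i * MvPolynomial.C (x i)) σ
  have hτ : ¬ AlgebraicIndependent k τ := fun h => by
    have h1 := h.lift_cardinalMk_le_trdeg
    rw [← trdeg_add_eq k D (A := M), MvPolynomial.trdeg_of_isDomain] at h1
    have h2 := h1.trans (Cardinal.lift_le.2 (add_le_add_left htr _))
    have h3 : #S + #{i // i ∉ S} = n := (Cardinal.mk_sum_compl S).trans (Cardinal.mk_fin n)
    have h4 : Cardinal.lift.{v} #S + Cardinal.lift.{v} #{i // i ∉ S} = n := by
      rw [← Cardinal.lift_add, h3, Cardinal.lift_natCast]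
    rw [h4] at h2
    simp only [Cardinal.mk_fin, Cardinal.lift_natCast, Nat.cast_le] at h2
    omega
  obtain ⟨g, hg, hg0⟩ : ∃ g, MvPolynomial.aeval τ g = 0 ∧ g ≠ 0 := by
    simpa [algebraicIndependent_iff] using hτ
  refine ⟨s, hs, g, hg0, fun c hc P hP hsP hcP => ?_⟩
  by_contra! hdP
  apply hc
  let K := FractionRing (D ⧸ P)
  let ev : D →ₐ[k] K := IsScalarTower.toAlgHom k D K
  have hev : ∀ y, ev y = 0 ↔ y ∈ P := fun y => by
    change algebraMap D K y = 0 ↔ _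
    rw [IsScalarTower.algebraMap_apply D (D ⧸ P) K,
      map_eq_zero_iff _ (IsFractionRing.injective (D ⧸ P) K)]
    exact Ideal.Quotient.eq_zero_iff_mem
  have hs0 : ev s ≠ 0 := fun h => hsP ((hev s).1 h)
  let E : M →ₐ[k] K := MvPolynomial.aevalTower ev fun i => algebraMap k K (c (i : Fin n).succ) / ev s
  have hEC : ∀ y, E (MvPolynomial.C y) = ev y :=
    fun y => MvPolynomial.aevalTower_C _ _ y
  have hEX : ∀ i, E (MvPolynomial.X i) = algebraMap k K (c (i : Fin n).succ) / ev s := fun i =>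
    MvPolynomial.aevalTower_X _ _ i
  have hσ : ∀ i, E (σ i) = algebraMap k K (c i.succ) := fun i => by
    by_cases hi : i ∈ S
    · simp only [σ, dif_pos hi]
      have h1 := (hev _).2 (hdP (d ⟨i, hi⟩))
      rw [affineForm, map_add, Derivation.map_algebraMap, zero_add, map_sum,
        ← Fintype.sum_subtype_add_sum_subtype (· ∈ S)] at h1
      simp only [Derivation.leibniz, Derivation.map_algebraMap, smul_eq_mul,
        map_add, map_sum, map_mul, AlgHom.commutes] at h1
      have h2 : ∀ j : {j // j ∈ S}, d ⟨i, hi⟩ (x j) = if (⟨i, hi⟩ : S) = j then s else 0 := hd _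
      simp only [h2, apply_ite ev, map_zero, mul_ite, mul_zero, add_zero, Finset.sum_ite_eq,
        Finset.mem_univ, if_true] at h1
      simp only [map_neg, map_sum, map_mul, hEC, hEX, mul_div_assoc']
      rw [← Finset.sum_div, ← neg_div, div_eq_iff hs0, neg_eq_iff_add_eq_zero, add_comm, ← h1]
      simp only [mul_comm]
    · simp only [σ, dif_neg hi]
      rw [map_mul, hEC, hEX, mul_div_cancel₀ _ hs0]
  have h0 : E (τ 0) = algebraMap k K (c 0) := by
    have h1 := (hev _).2 hcP
    rw [affineForm, map_add, map_sum, AlgHom.commutes] at h1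
    simp only [τ, Fin.cons_zero, map_neg, map_sum, map_mul, hσ, hEC]
    rw [eq_comm, ← add_eq_zero_iff_eq_neg]
    simpa using h1
  have hE : (fun i => E (τ i)) = algebraMap k K ∘ c := by
    funext i
    refine Fin.cases h0 (fun i => ?_) i
    simpa [τ] using hσ i
  have h2 : algebraMap k K (MvPolynomial.eval c g) = E (MvPolynomial.aeval τ g) := by
    rw [← AlgHom.comp_apply, MvPolynomial.comp_aeval, hE]
    exact (MvPolynomial.aeval_algebraMap_apply K c g).symm
  rw [hg, map_zero] at h2
  exact (map_eq_zero _).1 h2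

theorem finite_frobenius (k : Type*) {D : Type*} [Field k] [CommRing D] [Algebra k D]
    [Algebra.FiniteType k D] (p : ℕ) [Fact p.Prime] [CharP k p] [CharP D p] [PerfectRing k p] :
    (frobenius D p).Finite := by
  rw [RingHom.finite_iff_isIntegral_and_finiteType]
  refine ⟨fun y => ⟨Polynomial.X ^ p - Polynomial.C (y : D),
    Polynomial.monic_X_pow_sub_C y (Fact.out : p.Prime).ne_zero, by simp [frobenius_def]⟩, ?_⟩
  have h1 : (frobenius D p).comp (algebraMap k D) = (algebraMap k D).comp (frobenius k p) := by
    ext a; simp [frobenius_def]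
  have h2 : ((algebraMap k D).comp (frobenius k p)).FiniteType :=
    ((RingHom.finiteType_algebraMap).2 inferInstance).comp
      (RingHom.FiniteType.of_surjective _ (PerfectRing.bijective_frobenius (R := k) (p := p)).2)
  exact RingHom.FiniteType.of_comp_finiteType (h1 ▸ h2)

theorem finite_iterateFrobenius {D : Type*} [CommRing D] {p : ℕ} [ExpChar D p]
    (h : (frobenius D p).Finite) (e : ℕ) : (iterateFrobenius D p e).Finite := by
  induction e with
  | zero => rw [iterateFrobenius_zero]; exact RingHom.Finite.id D
  | succ e ih =>
    have : iterateFrobenius D p (e + 1) = (iterateFrobenius D p e).comp (frobenius D p) := by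
      ext x; simp [iterateFrobenius_def, frobenius_def, pow_succ', pow_mul]
    rw [this]
    exact ih.comp h

/-- For `h` the equation of a general hyperplane section, the maps `(Φ (h ^ (p - 1) * ·))^[e]`
detect membership in `(h)` away from a fixed hypersurface. -/
theorem IsCartierLinear.exists_forall_hyperplane {k : Type u} {D : Type v} [Field k] [CommRing D]
    [IsDomain D] [Algebra k D] {n : ℕ} {x : Fin n → D} (hx : Algebra.adjoin k (Set.range x) = ⊤)
    {p : ℕ} [Fact p.Prime] [CharP k p] [PerfectRing k p] :
    ∃ Φ : D →+ D, IsCartierLinear p 1 Φ ∧ ∃ f : D, f ≠ 0 ∧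
      ∃ g : MvPolynomial (Fin (n + 1)) k, g ≠ 0 ∧
        ∀ c : Fin (n + 1) → k, MvPolynomial.eval c g ≠ 0 → ∀ P : Ideal D, P.IsPrime → f ∉ P →
          affineForm x c ∈ P → ∀ b,
            (∀ e, 1 ≤ e → ∀ a, (fun y => Φ (affineForm x c ^ (p - 1) * y))^[e] (b * a) ∈ P) →
            ∃ s ∉ P, s * b ∈ Ideal.span {affineForm x c} := by
  have : Algebra.FiniteType k D := ⟨⟨(Set.finite_range x).toFinset, by simpa using hx⟩⟩
  have : CharP D p := charP_of_injective_algebraMap (algebraMap k D).injective p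
  have : IsNoetherianRing D := Algebra.FiniteType.isNoetherianRing k D
  obtain ⟨Φ, f₁, hΦ, hf₁, hgen⟩ := exists_generator (finite_frobenius k (D := D) p)
  obtain ⟨f₂, hf₂, g, hg, h⟩ := exists_derivation_hyperplane_not_mem hx
  refine ⟨Φ, hΦ, f₁ * f₂, mul_ne_zero hf₁ hf₂, g, hg, fun c hc P hP hfP hcP b hb => ?_⟩
  obtain ⟨d, hd⟩ := h c hc P hP (fun h => hfP (P.mul_mem_left _ h)) hcP
  exact exists_mul_mem_span_of_iterate_mem hΦ hgen hP (fun h => hfP (P.mul_mem_right _ h)) hcP d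
    hd hb

theorem IsCartierLinear.exists_forall_hyperplane_of_not_mem {k : Type u} {A : Type v} [Field k]
    [CommRing A] [Algebra k A] {n : ℕ} {x : Fin n → A} (hx : Algebra.adjoin k (Set.range x) = ⊤)
    {p : ℕ} [Fact p.Prime] [CharP k p] [PerfectRing k p] {Q : Ideal A} (hQ : Q.IsPrime) {e : ℕ}
    {φ : A →+ A} (hφ : IsCartierLinear p e φ) {b : A} (hb : φ b ∉ Q) :
    ∃ f ∉ Q, ∃ g : MvPolynomial (Fin (n + 1)) k, g ≠ 0 ∧
      ∀ c : Fin (n + 1) → k, MvPolynomial.eval c g ≠ 0 → ∀ P : Ideal A, P.IsPrime → Q ≤ P →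
        f ∉ P → affineForm x c ∈ P →
          ∃ ψ : A →+ A, IsCartierLinear p e ψ ∧ ψ (affineForm x c ^ (p ^ e - 1) * b) ∉ P := by
  have hp : p.Prime := Fact.out
  have : Algebra.FiniteType k A := ⟨⟨(Set.finite_range x).toFinset, by simpa using hx⟩⟩
  have : IsNoetherianRing A := Algebra.FiniteType.isNoetherianRing k A
  let π := Ideal.Quotient.mkₐ k Q
  have hπ : Function.Surjective π := Ideal.Quotient.mkₐ_surjective k Q
  have hπ0 : ∀ y, π y = 0 ↔ y ∈ Q := fun y => Ideal.Quotient.eq_zero_iff_mem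
  have hx' : Algebra.adjoin k (Set.range (π ∘ x)) = ⊤ := by
    rw [Set.range_comp, ← AlgHom.map_adjoin, hx, Algebra.map_top, AlgHom.range_eq_top]
    exact hπ
  have : CharP (A ⧸ Q) p := charP_of_injective_algebraMap (algebraMap k (A ⧸ Q)).injective p
  obtain ⟨a, ψ, hψ, hψQ, hψ1⟩ := exists_compatible hφ hb
  obtain ⟨ψ', hψ', hψπ⟩ := exists_of_surjective (π := π.toRingHom) hπ
    (hψ.comp_mulLeft (b * a)) fun y hy => (hπ0 _).2 (hψQ y ((hπ0 y).1 hy))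
  replace hψπ : ∀ y, ψ' (π y) = π (ψ (b * a * y)) := hψπ
  obtain ⟨Φ, hΦ, f, hf, g, hg, h⟩ := exists_forall_hyperplane hx' (p := p)
  obtain ⟨φ', hφ', hφΦ⟩ := iterate_mul_eq hp hΦ e
  obtain ⟨s, β, hs, hβ⟩ := exists_mul_eq hp
    (finite_iterateFrobenius (finite_frobenius k (D := A ⧸ Q) p) e) hψ'
    ⟨π 1, by rwa [hψπ, mul_one, Ne, hπ0]⟩ hφ'
  obtain ⟨f', hf'⟩ := hπ (f * s)
  refine ⟨f', fun h => mul_ne_zero hf hs (hf' ▸ (hπ0 _).2 h), g, hg,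
    fun c hc P hP hQP hfP hcP => ?_⟩
  obtain ⟨P, hP', rfl⟩ : ∃ P' : Ideal (A ⧸ Q), P'.IsPrime ∧ P'.comap π = P :=
    ⟨P.map π, Ideal.map_isPrime_of_surjective hπ fun y hy => hQP ((hπ0 y).1 hy), Ideal.comap_map_mk hQP⟩
  rw [Ideal.mem_comap, hf'] at hfP
  rw [Ideal.mem_comap, map_affineForm] at hcP
  obtain ⟨e', he', z, hz⟩ : ∃ e', 1 ≤ e' ∧ ∃ z,
      (fun y => Φ (affineForm (π ∘ x) c ^ (p - 1) * y))^[e'] z ∉ P := by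
    by_contra! hcon
    obtain ⟨s, hs, hsb⟩ := h c hc P hP' (fun h => hfP (P.mul_mem_right _ h)) hcP 1
      fun e he a => hcon e he _
    rw [mul_one] at hsb
    exact hs ((Ideal.span_singleton_le_iff_mem _).2 hcP hsb)
  obtain ⟨e', rfl⟩ := Nat.exists_eq_add_of_le' he'
  rw [Function.iterate_succ_apply'] at hz
  obtain ⟨y, hy⟩ := iterate_not_mem hp (hΦ.comp_mulLeft _) hP' hz e
  have h1 : s * φ' (affineForm (π ∘ x) c ^ (p ^ e - 1) * y) ∉ P := fun hmem =>
    (hP'.mem_or_mem hmem).elim (fun h => hfP (P.mul_mem_left _ h)) fun h => hy (hφΦ _ _ ▸ h)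
  rw [hβ] at h1
  obtain ⟨t, ht⟩ := hπ (β * y)
  refine ⟨_, hψ.comp_mulLeft (a * t), fun hmem => h1 ?_⟩
  rw [Ideal.mem_comap, AddMonoidHom.comp_apply, AddMonoidHom.coe_mulLeft] at hmem
  rw [mul_left_comm, ← ht, ← map_affineForm, ← map_pow, ← map_mul, hψπ]
  convert hmem using 3
  ring

/-- Noetherian induction for statements about the points of `Spec A` and a general parameter. -/
theorem exists_forall_of_forall_isPrime {k A : Type*} [CommRing k] [IsDomain k] [CommRing A]
    [IsNoetherianRing A] {m : ℕ} (T : (Fin m → k) → Ideal A → Prop)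
    (h : ∀ Q : Ideal A, Q.IsPrime → ∃ f ∉ Q, ∃ g : MvPolynomial (Fin m) k, g ≠ 0 ∧
      ∀ c, MvPolynomial.eval c g ≠ 0 → ∀ P : Ideal A, P.IsPrime → Q ≤ P → f ∉ P → T c P) :
    ∃ g : MvPolynomial (Fin m) k, g ≠ 0 ∧
      ∀ c, MvPolynomial.eval c g ≠ 0 → ∀ P : Ideal A, P.IsPrime → T c P := by
  suffices H : ∀ J : Ideal A, ∃ g : MvPolynomial (Fin m) k, g ≠ 0 ∧
      ∀ c, MvPolynomial.eval c g ≠ 0 → ∀ P : Ideal A, P.IsPrime → J ≤ P → T c P by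
    obtain ⟨g, hg, hT⟩ := H ⊥
    exact ⟨g, hg, fun c hc P hP => hT c hc P hP bot_le⟩
  intro J
  induction J using WellFoundedGT.induction with
  | ind J ih =>
    have hlt : ∀ {a}, a ∉ J → J < J ⊔ Ideal.span {a} := fun ha =>
      left_lt_sup.2 fun hle => ha (hle (Ideal.mem_span_singleton_self _))
    have hle : ∀ {P : Ideal A} {a}, J ≤ P → a ∈ P → J ⊔ Ideal.span {a} ≤ P := fun hJ ha =>
      sup_le hJ ((Ideal.span_singleton_le_iff_mem _).2 ha)
    by_cases hJ : J.IsPrime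
    · obtain ⟨f, hf, g₁, hg₁, h₁⟩ := h J hJ
      obtain ⟨g₂, hg₂, h₂⟩ := ih _ (hlt hf)
      refine ⟨g₁ * g₂, mul_ne_zero hg₁ hg₂, fun c hc P hP hJP => ?_⟩
      rw [map_mul] at hc
      by_cases hfP : f ∈ P
      · exact h₂ c (right_ne_zero_of_mul hc) P hP (hle hJP hfP)
      · exact h₁ c (left_ne_zero_of_mul hc) P hP hJP hfP
    by_cases hJ' : J = ⊤
    · exact ⟨1, one_ne_zero, fun c _ P hP hJP => (hP.ne_top (top_le_iff.1 (hJ' ▸ hJP))).elim⟩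
    obtain ⟨a, ha, b, hb, hab⟩ := (Ideal.not_isPrime_iff.1 hJ).resolve_left hJ'
    obtain ⟨g₁, hg₁, h₁⟩ := ih _ (hlt ha)
    obtain ⟨g₂, hg₂, h₂⟩ := ih _ (hlt hb)
    refine ⟨g₁ * g₂, mul_ne_zero hg₁ hg₂, fun c hc P hP hJP => ?_⟩
    rw [map_mul] at hc
    rcases hP.mem_or_mem (hJP hab) with h | h
    · exact h₁ c (left_ne_zero_of_mul hc) P hP (hle hJP h)
    · exact h₂ c (right_ne_zero_of_mul hc) P hP (hle hJP h)

theorem isReduced_of_isCartierLinear {R : Type*} [CommRing R] {p e : ℕ} (hp : p.Prime) (he : 1 ≤ e)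
    {φ : R →+ R} (hφ : IsCartierLinear p e φ) (h1 : φ 1 = 1) : IsReduced R := by
  have key : ∀ x : R, x ^ p ^ e = 0 → x = 0 := fun x hx => by
    simpa [hx, h1] using (hφ x 1).symm
  have hpe : 1 < p ^ e := Nat.one_lt_pow (by omega) hp.one_lt
  refine ⟨fun x ⟨m, hm⟩ => ?_⟩
  have key' : ∀ (j : ℕ) (x : R), x ^ (p ^ e) ^ j = 0 → x = 0 := fun j => by
    induction j with
    | zero => simp
    | succ j ih => exact fun x hx => key x (ih _ (by rw [← pow_mul, ← pow_succ', hx]))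
  exact key' m x (pow_eq_zero_of_le (Nat.lt_pow_self hpe).le hm)

theorem exists_forall_hyperplane_stronglyFRegular {k : Type u} {A : Type v} [Field k]
    [CommRing A] [IsDomain A] [Algebra k A] {n : ℕ} {x : Fin n → A}
    (hx : Algebra.adjoin k (Set.range x) = ⊤) {p : ℕ} [Fact p.Prime] [CharP k p] [PerfectRing k p]
    (hFR : ∀ c : A, c ≠ 0 → ∃ e : ℕ, 1 ≤ e ∧ ∃ φ : A →+ A, IsCartierLinear p e φ ∧ φ c = 1) :
    ∃ g : MvPolynomial (Fin (n + 1)) k, g ≠ 0 ∧ ∀ c : Fin (n + 1) → k, MvPolynomial.eval c g ≠ 0 →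
      IsReduced (A ⧸ Ideal.span {affineForm x c}) ∧
        ∀ b : A ⧸ Ideal.span {affineForm x c},
          (∀ P ∈ minimalPrimes (A ⧸ Ideal.span {affineForm x c}), b ∉ P) →
            ∃ e : ℕ, 1 ≤ e ∧
              ∃ φ : (A ⧸ Ideal.span {affineForm x c}) →+ (A ⧸ Ideal.span {affineForm x c}),
                IsCartierLinear p e φ ∧ φ b = 1 := by
  have hp : p.Prime := Fact.out
  have : Algebra.FiniteType k A := ⟨⟨(Set.finite_range x).toFinset, by simpa using hx⟩⟩
  have : IsNoetherianRing A := Algebra.FiniteType.isNoetherianRing k A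
  obtain ⟨Φ, hΦ, f, hf, g₁, hg₁, h₁⟩ := IsCartierLinear.exists_forall_hyperplane hx (p := p)
  obtain ⟨e₀, he₀, φ₀, hφ₀, hφf⟩ := hFR f hf
  obtain ⟨g₂, hg₂, h₂⟩ := exists_forall_of_forall_isPrime
    (fun c (P : Ideal A) => affineForm x c ∈ P →
      ∃ ψ : A →+ A, IsCartierLinear p e₀ ψ ∧ ψ (affineForm x c ^ (p ^ e₀ - 1) * f) ∉ P)
    fun Q hQ => IsCartierLinear.exists_forall_hyperplane_of_not_mem hx hQ hφ₀
      (b := f) (hφf ▸ hQ.one_notMem)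
  refine ⟨g₁ * g₂, mul_ne_zero hg₁ hg₂, fun c hc => ?_⟩
  rw [map_mul] at hc
  specialize h₁ c (left_ne_zero_of_mul hc)
  specialize h₂ c (right_ne_zero_of_mul hc)
  set h := affineForm x c
  let π := Ideal.Quotient.mk (Ideal.span {h})
  have hπ : Function.Surjective π := Ideal.Quotient.mk_surjective
  have hmem : ∀ P : Ideal (A ⧸ Ideal.span {h}), h ∈ P.comap π := fun P => by
    rw [Ideal.mem_comap, Ideal.Quotient.eq_zero_iff_mem.2 (Ideal.mem_span_singleton_self h)]
    exact P.zero_mem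
  have hfB : ∃ e, 1 ≤ e ∧ ∃ φ : (A ⧸ Ideal.span {h}) →+ (A ⧸ Ideal.span {h}),
      IsCartierLinear p e φ ∧ φ (π f) = 1 :=
    IsCartierLinear.exists_eq_one_of_forall_isPrime hp fun P hP => by
      obtain ⟨ψ, hψ, hψP⟩ := h₂ (P.comap π) (hP.comap π) (hmem P)
      obtain ⟨ψ', hψ', hψπ⟩ := IsCartierLinear.exists_quotient_span_singleton hp h hψ
      exact ⟨e₀, he₀, ψ', hψ', by rw [hψπ]; exact hψP⟩
  have key : ∀ b : A ⧸ Ideal.span {h},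
      (∀ P ∈ minimalPrimes (A ⧸ Ideal.span {h}), b ∉ P) → ∃ e, 1 ≤ e ∧
        ∃ φ : (A ⧸ Ideal.span {h}) →+ (A ⧸ Ideal.span {h}), IsCartierLinear p e φ ∧ φ b = 1 := by
    intro b hb
    refine IsCartierLinear.exists_eq_one_of_forall_not_mem hp hfB fun P hP hfP => ?_
    obtain ⟨b, rfl⟩ := hπ b
    obtain ⟨e, he, a, hea⟩ : ∃ e, 1 ≤ e ∧ ∃ a,
        (fun y => Φ (h ^ (p - 1) * y))^[e] (b * a) ∉ P.comap π := by
      by_contra! hcon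
      obtain ⟨s, hs, hsb⟩ := h₁ (P.comap π) (hP.comap π) hfP (hmem P) b hcon
      obtain ⟨P₀, hP₀, hP₀P⟩ := Ideal.exists_minimalPrimes_le (bot_le : ⊥ ≤ P)
      refine hb P₀ hP₀ ((hP₀.1.1.mem_or_mem ?_).resolve_left fun h => hs (hP₀P h))
      rw [← map_mul, Ideal.Quotient.eq_zero_iff_mem.2 hsb]
      exact P₀.zero_mem
    obtain ⟨φ, hφ, hφΦ⟩ := IsCartierLinear.iterate_mul_eq hp hΦ e
    obtain ⟨ψ, hψ, hψπ⟩ := IsCartierLinear.exists_quotient_span_singleton hp h hφ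
    refine ⟨e, he, _, hψ.comp_mulLeft (π a), ?_⟩
    rw [AddMonoidHom.comp_apply, AddMonoidHom.coe_mulLeft, mul_comm, ← map_mul, hψπ, hφΦ]
    exact hea
  refine ⟨?_, key⟩
  obtain ⟨e, he, φ, hφ, hφ1⟩ := key 1 fun P hP => hP.1.1.one_notMem
  exact isReduced_of_isCartierLinear hp he hφ hφ1

/-- Bertini's second theorem for strong `F`-regularity (affine form): if `k` is an
algebraically closed field of characteristic `p > 0`, `I` is a prime ideal of
`k[x₁,…,xₙ]` and the domain `A = k[x₁,…,xₙ]/I` is strongly `F`-regular (for every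
nonzero `c` there are `e ≥ 1` and an additive `φ : A → A` with
`φ (r ^ p ^ e * x) = r * φ x` and `φ c = 1`), then there is a nonzero polynomial
`g ∈ k[T₀,…,Tₙ]` such that for every `(c₀,…,cₙ) ∈ k^{n+1}` with `g c ≠ 0`, the
hyperplane section `B = A/(c₀ + c₁x₁ + ⋯ + cₙxₙ)` is strongly `F`-regular: `B` is
reduced and for every `b ∈ B` not contained in any minimal prime of `B` there exist
`e ≥ 1` and an additive `φ : B → B` with `φ (r ^ p ^ e * x) = r * φ x` and `φ b = 1`. -/
theorem bertini_stronglyFRegular (k : Type*) [Field k] [IsAlgClosed k] (p : ℕ)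
    (hp : p.Prime) [CharP k p] (n : ℕ) (I : Ideal (MvPolynomial (Fin n) k)) (hI : I.IsPrime)
    (hFR : ∀ c : MvPolynomial (Fin n) k ⧸ I, c ≠ 0 → ∃ e : ℕ, 1 ≤ e ∧
      ∃ φ : (MvPolynomial (Fin n) k ⧸ I) →+ (MvPolynomial (Fin n) k ⧸ I),
        (∀ r x, φ (r ^ p ^ e * x) = r * φ x) ∧ φ c = 1) :
    ∃ g : MvPolynomial (Fin (n + 1)) k, g ≠ 0 ∧
      ∀ c : Fin (n + 1) → k, MvPolynomial.eval c g ≠ 0 →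
        IsReduced (HyperplaneSection k n I c) ∧
        ∀ b : HyperplaneSection k n I c,
          (∀ P ∈ minimalPrimes (HyperplaneSection k n I c), b ∉ P) →
          ∃ e : ℕ, 1 ≤ e ∧
            ∃ φ : HyperplaneSection k n I c →+ HyperplaneSection k n I c,
              (∀ r x, φ (r ^ p ^ e * x) = r * φ x) ∧ φ b = 1 := by
  have := Fact.mk hp
  have hx : Algebra.adjoin k (Set.range fun i => Ideal.Quotient.mkₐ k I (MvPolynomial.X i)) = ⊤ := by
    rw [Set.range_comp' (Ideal.Quotient.mkₐ k I) MvPolynomial.X, ← AlgHom.map_adjoin,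
      MvPolynomial.adjoin_range_X, Algebra.map_top, AlgHom.range_eq_top]
    exact Ideal.Quotient.mkₐ_surjective k I
  obtain ⟨g, hg, h⟩ := exists_forall_hyperplane_stronglyFRegular hx (p := p) hFR
  refine ⟨g, hg, fun c hc => ?_⟩
  have hform : Ideal.Quotient.mk I
      (MvPolynomial.C (c 0) + ∑ i : Fin n, MvPolynomial.C (c i.succ) * MvPolynomial.X i) =
      affineForm (fun i => Ideal.Quotient.mkₐ k I (MvPolynomial.X i)) c :=
    map_affineForm (Ideal.Quotient.mkₐ k I) MvPolynomial.X c
  have hB := h c hc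
  rw [← hform] at hB
  exact hB
end

section
/- Let (R, 𝔪) → (S, 𝔫) be a flat local homomorphism of Noetherian local rings and let y_1, …, y_t ∈ 𝔫 be elements whose images in the closed fiber S/𝔪S form a regular sequence on S/𝔪S. Then: (a) y_1, …, y_t form a regular sequence on S; (b) S/(y_1, …, y_t)S is a flat (hence faithfully flat) R-module, so R → S/(y_1, …, y_t) is again a faithfully flat local homomorphism; and (c) for every nonzero finitely generated R-module M, the elements y_1, …, y_t form a regular sequence on S ⊗_R M. -/
open TensorProduct IsLocalRing

section

variable {R S N : Type*} [CommRing R] [CommRing S] [Algebra R S] [AddCommGroup N] [Module R N]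
  [Module S N] [IsScalarTower R S N]

/-- Reducing modulo `y` commutes with tensoring on the right over a smaller base ring. -/
noncomputable def quotSMulTopTensorEquivOfScalarTower (y : S) (M : Type*) [AddCommGroup M]
    [Module R M] : QuotSMulTop y N ⊗[R] M ≃ₗ[S] QuotSMulTop y (N ⊗[R] M) :=
  TensorProduct.AlgebraTensorModule.congr (QuotSMulTop.equivQuotTensor y N)
      (LinearEquiv.refl R M) ≪≫ₗ
    TensorProduct.AlgebraTensorModule.assoc R S S (S ⧸ Ideal.span {y}) N M ≪≫ₗ
      (QuotSMulTop.equivQuotTensor y (N ⊗[R] M)).symm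

/-- For `N` flat over `R`, an element regular on `N ⊗ P` and on `N ⊗ (M ⧸ P)` is regular on
`N ⊗ M`. -/
lemma isSMulRegular_tensor_of_submodule [Module.Flat R N] {M : Type*} [AddCommGroup M]
    [Module R M] (P : Submodule R M) {y : S} (hP : IsSMulRegular (N ⊗[R] P) y)
    (hQ : IsSMulRegular (N ⊗[R] (M ⧸ P)) y) : IsSMulRegular (N ⊗[R] M) y := by
  refine isSMulRegular_of_range_eq_ker
    (f := AlgebraTensorModule.map (LinearMap.id : N →ₗ[S] N) P.subtype)
    (g := AlgebraTensorModule.map (LinearMap.id : N →ₗ[S] N) P.mkQ) ?_ ?_ hP hQ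
  · exact Module.Flat.lTensor_preserves_injective_linearMap (M := N) P.subtype
      P.injective_subtype
  · ext x
    exact (lTensor_exact N (LinearMap.exact_subtype_mkQ P) P.mkQ_surjective x).symm

lemma isSMulRegular_tensor_of_smul_eq_zero {𝔪 : Ideal R} [𝔪.IsMaximal] {M : Type*}
    [AddCommGroup M] [Module R M] (hM : Module.IsTorsionBySet R M 𝔪) {y : S}
    (hy : IsSMulRegular (N ⊗[R] (R ⧸ 𝔪)) y) : IsSMulRegular (N ⊗[R] M) y := by
  let : Field (R ⧸ 𝔪) := Ideal.Quotient.field 𝔪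
  let : Module (R ⧸ 𝔪) M := hM.module
  have : IsScalarTower R (R ⧸ 𝔪) M := hM.isScalarTower
  let b := Module.Free.chooseBasis (R ⧸ 𝔪) M
  let e : N ⊗[R] M ≃ₗ[S] (_ →₀ N ⊗[R] (R ⧸ 𝔪)) := by
    classical
    exact TensorProduct.AlgebraTensorModule.congr (LinearEquiv.refl S N)
      (b.repr.restrictScalars R) ≪≫ₗ TensorProduct.finsuppRight R S N (R ⧸ 𝔪) _
  rw [e.isSMulRegular_congr]
  intro f g hfg
  ext1 i
  exact hy (DFunLike.congr_fun hfg i)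

lemma isSMulRegular_tensor_of_pow_smul_eq_zero [Module.Flat R N] {𝔪 : Ideal R} [𝔪.IsMaximal]
    {y : S} (hy : IsSMulRegular (N ⊗[R] (R ⧸ 𝔪)) y) (n : ℕ) {M : Type*} [AddCommGroup M]
    [Module R M] (hM : 𝔪 ^ n • (⊤ : Submodule R M) = ⊥) : IsSMulRegular (N ⊗[R] M) y := by
  suffices H : ∀ P : Submodule R M, 𝔪 ^ n • P = ⊥ → IsSMulRegular (N ⊗[R] P) y from
    ((TensorProduct.AlgebraTensorModule.congr (LinearEquiv.refl S N)
      Submodule.topEquiv).isSMulRegular_congr y).mp (H ⊤ hM)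
  clear hM
  induction n with
  | zero =>
    intro P hP
    obtain rfl : P = ⊥ := by simpa using hP
    exact fun _ _ _ ↦ Subsingleton.elim _ _
  | succ n ih =>
    intro P hP
    let Q : Submodule R P := 𝔪 • ⊤
    have hQ : Q.map P.subtype = 𝔪 • P := by simp [Q, Submodule.map_smul'']
    refine isSMulRegular_tensor_of_submodule Q ?_ ?_
    · let e : Q ≃ₗ[R] (𝔪 • P : Submodule R M) :=
        Submodule.equivMapOfInjective _ P.injective_subtype Q ≪≫ₗ LinearEquiv.ofEq _ _ hQ
      rw [(TensorProduct.AlgebraTensorModule.congr (LinearEquiv.refl S N)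
        e).isSMulRegular_congr]
      exact ih _ (by rw [← Submodule.mul_smul, ← pow_succ, hP])
    · refine isSMulRegular_tensor_of_smul_eq_zero (𝔪 := 𝔪) ?_ hy
      rintro x ⟨a, ha⟩
      obtain ⟨x, rfl⟩ := Q.mkQ_surjective x
      exact (Submodule.Quotient.mk_eq_zero Q).mpr (Submodule.smul_mem_smul ha trivial)

lemma rTensor_lsmul_apply (y : S) {M : Type*} [AddCommGroup M] [Module R M] (t : N ⊗[R] M) :
    ((LinearMap.lsmul S N y).restrictScalars R).rTensor M t = y • t := by
  induction t with
  | zero => simp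
  | add a b ha hb => rw [map_add, ha, hb, smul_add]
  | tmul a p => rfl

lemma finite_tensorProduct_of_isScalarTower [Module.Finite S N] (M : Type*) [AddCommGroup M]
    [Module R M] [Module.Finite R M] : Module.Finite S (N ⊗[R] M) :=
  Module.Finite.equiv (TensorProduct.AlgebraTensorModule.cancelBaseChange R S S N M)

lemma lTensor_subtype_mem_pow_smul_top {I : Ideal R} {J : Ideal S}
    (hIJ : I ≤ J.comap (algebraMap R S)) (n : ℕ) {M : Type*} [AddCommGroup M] [Module R M]
    (w : N ⊗[R] (I ^ n • ⊤ : Submodule R M)) :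
    (I ^ n • ⊤ : Submodule R M).subtype.lTensor N w ∈
      J ^ n • (⊤ : Submodule S (N ⊗[R] M)) := by
  induction w with
  | zero => simp
  | add a b ha hb => simpa only [map_add] using add_mem ha hb
  | tmul a p =>
    obtain ⟨p, hp⟩ := p
    simp only [LinearMap.lTensor_tmul, Submodule.subtype_apply]
    induction hp using Submodule.smul_induction_on' with
    | smul r hr m _ =>
      rw [TensorProduct.tmul_smul, ← algebraMap_smul S r]
      refine Submodule.smul_mem_smul ?_ trivial
      exact Ideal.pow_right_mono (Ideal.map_le_iff_le_comap.mpr hIJ) n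
        (Ideal.map_pow (algebraMap R S) I n ▸ Ideal.mem_map_of_mem _ hr)
    | add x _ y _ hx hy => simpa only [TensorProduct.tmul_add] using add_mem hx hy

section IsLocalRing

variable [IsLocalRing R] [IsLocalRing S] [IsNoetherianRing S] [IsLocalHom (algebraMap R S)]
  [Module.Finite S N] [Module.Flat R N]

lemma isSMulRegular_tensor_of_closedFiber {y : S}
    (hy : IsSMulRegular (N ⊗[R] (R ⧸ maximalIdeal R)) y) (M : Type*) [AddCommGroup M]
    [Module R M] [Module.Finite R M] : IsSMulRegular (N ⊗[R] M) y := by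
  have : Module.Finite S (N ⊗[R] M) := finite_tensorProduct_of_isScalarTower M
  refine IsSMulRegular.of_right_eq_zero_of_smul fun z hz ↦ ?_
  suffices h : z ∈ ⨅ n : ℕ, maximalIdeal S ^ n • (⊤ : Submodule S (N ⊗[R] M)) by
    rwa [Ideal.iInf_pow_smul_eq_bot_of_isLocalRing _ (Ideal.IsPrime.ne_top inferInstance)] at h
  refine (Submodule.mem_iInf _).mpr fun n ↦ ?_
  let P : Submodule R M := maximalIdeal R ^ n • ⊤
  have hreg : IsSMulRegular (N ⊗[R] (M ⧸ P)) y := by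
    refine isSMulRegular_tensor_of_pow_smul_eq_zero hy n ?_
    rw [← P.range_mkQ, ← Submodule.map_top, ← Submodule.map_smul'']
    exact P.mkQ_map_self
  let g := AlgebraTensorModule.map (LinearMap.id : N →ₗ[S] N) P.mkQ
  have hgz : g z = 0 := hreg.right_eq_zero_of_smul (by rw [← map_smul, hz, map_zero])
  obtain ⟨w, rfl⟩ := (lTensor_exact N (LinearMap.exact_subtype_mkQ P) P.mkQ_surjective z).mp hgz
  have hle : maximalIdeal R ≤ (maximalIdeal S).comap (algebraMap R S) :=
    ((local_hom_TFAE (algebraMap R S)).out 0 3).mp ‹_›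
  exact lTensor_subtype_mem_pow_smul_top hle n w

lemma flat_of_exact_lsmul_of_closedFiber {y : S}
    (hy : IsSMulRegular (N ⊗[R] (R ⧸ maximalIdeal R)) y) {N' : Type*} [AddCommGroup N']
    [Module R N'] (q : N →ₗ[R] N') (hq : Function.Surjective q)
    (hyq : Function.Exact ((LinearMap.lsmul S N y).restrictScalars R) q) :
    Module.Flat R N' := by
  refine Module.Flat.iff_lTensor_injective'.mpr fun I ↦ ?_
  rw [injective_iff_map_eq_zero]
  intro w' hw'
  have hinj : Function.Injective (I.subtype.lTensor N) :=
    Module.Flat.lTensor_preserves_injective_linearMap _ I.injective_subtype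
  have hex : Function.Exact (I.subtype.lTensor N) (I.mkQ.lTensor N) :=
    lTensor_exact N (LinearMap.exact_subtype_mkQ I) I.mkQ_surjective
  have hsmul {P Q : Type _} [AddCommGroup P] [Module R P] [AddCommGroup Q] [Module R Q]
      (f : P →ₗ[R] Q) (t : N ⊗[R] P) : f.lTensor N (y • t) = y • f.lTensor N t :=
    map_smul (AlgebraTensorModule.map (LinearMap.id : N →ₗ[S] N) f) y t
  obtain ⟨w, rfl⟩ := LinearMap.rTensor_surjective I hq w'
  have hcomm : q.rTensor R (I.subtype.lTensor N w) = 0 := by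
    rw [← hw', ← LinearMap.comp_apply, ← LinearMap.comp_apply, LinearMap.rTensor_comp_lTensor,
      LinearMap.lTensor_comp_rTensor]
  obtain ⟨n, hn⟩ := (rTensor_exact R hyq hq _).mp hcomm
  rw [rTensor_lsmul_apply] at hn
  have hn0 : I.mkQ.lTensor N n = 0 :=
    (isSMulRegular_tensor_of_closedFiber hy (R ⧸ I)).right_eq_zero_of_smul
      (by rw [← hsmul, hn, hex.apply_apply_eq_zero])
  obtain ⟨v, rfl⟩ := (hex n).mp hn0
  obtain rfl : y • v = w := hinj ((hsmul _ v).trans hn)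
  rw [← rTensor_lsmul_apply]
  exact (rTensor_exact I hyq hq).apply_apply_eq_zero v

lemma flat_quotSMulTop_of_closedFiber {y : S}
    (hy : IsSMulRegular (N ⊗[R] (R ⧸ maximalIdeal R)) y) : Module.Flat R (QuotSMulTop y N) :=
  have hq : Function.Surjective (Submodule.mkQ _ : N →ₗ[S] QuotSMulTop y N) :=
    Submodule.mkQ_surjective _
  flat_of_exact_lsmul_of_closedFiber hy
    ((Submodule.mkQ _ : N →ₗ[S] QuotSMulTop y N).restrictScalars R) hq
    (LinearMap.exact_lsmul_mkQ_smul_top N y)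

theorem isWeaklyRegular_tensor_of_closedFiber {ys : List S}
    (hys : RingTheory.Sequence.IsWeaklyRegular (N ⊗[R] (R ⧸ maximalIdeal R)) ys)
    (M : Type*) [AddCommGroup M] [Module R M] [Module.Finite R M] :
    RingTheory.Sequence.IsWeaklyRegular (N ⊗[R] M) ys := by
  induction ys generalizing N with
  | nil => exact .nil S _
  | cons y ys ih =>
    rw [RingTheory.Sequence.isWeaklyRegular_cons_iff] at hys
    have := flat_quotSMulTop_of_closedFiber hys.1
    have hreg := ih (N := QuotSMulTop y N)
      (((quotSMulTopTensorEquivOfScalarTower y _).isWeaklyRegular_congr ys).mpr hys.2)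
    exact .cons (isSMulRegular_tensor_of_closedFiber hys.1 M)
      (((quotSMulTopTensorEquivOfScalarTower y M).isWeaklyRegular_congr ys).mp hreg)

theorem flat_quotient_ofList_of_closedFiber {ys : List S}
    (hys : RingTheory.Sequence.IsWeaklyRegular (N ⊗[R] (R ⧸ maximalIdeal R)) ys) :
    Module.Flat R (N ⧸ (Ideal.ofList ys • ⊤ : Submodule S N)) := by
  induction ys generalizing N with
  | nil =>
    exact .of_linearEquiv ((Submodule.quotEquivOfEqBot _ (by simp)).restrictScalars R)
  | cons y ys ih =>
    rw [RingTheory.Sequence.isWeaklyRegular_cons_iff] at hys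
    have := flat_quotSMulTop_of_closedFiber hys.1
    have hflat := ih (N := QuotSMulTop y N)
      (((quotSMulTopTensorEquivOfScalarTower y _).isWeaklyRegular_congr ys).mpr hys.2)
    exact .of_linearEquiv ((Submodule.quotOfListConsSMulTopEquivQuotSMulTopInner
      N y ys).restrictScalars R)

end IsLocalRing

end

/-- Let `(R,𝔪) → (S,𝔫)` be a flat local homomorphism of Noetherian local rings and let
`ys` be a list of elements of `𝔫` whose images in the closed fiber `S/𝔪S` form a regular
sequence on `S/𝔪S`.  Then (a) `ys` is a regular sequence on `S`; (b) `S/(ys)` is flat,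
and indeed faithfully flat, over `R`, and `R → S/(ys)` is again a local homomorphism of
local rings; (c) for every nonzero finitely generated `R`-module `M`, the list `ys` is a
regular sequence on `S ⊗_R M`. -/
theorem flat_local_regular_sequence_on_closed_fiber (R S : Type*) [CommRing R] [CommRing S]
    [IsLocalRing R] [IsLocalRing S] [IsNoetherianRing R] [IsNoetherianRing S]
    [Algebra R S] [IsLocalHom (algebraMap R S)] [Module.Flat R S]
    (ys : List S) (hys : ∀ y ∈ ys, y ∈ maximalIdeal S)
    (hreg : RingTheory.Sequence.IsRegular
      (S ⧸ Ideal.map (algebraMap R S) (maximalIdeal R))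
      (ys.map (algebraMap S (S ⧸ Ideal.map (algebraMap R S) (maximalIdeal R))))) :
    RingTheory.Sequence.IsRegular S ys ∧
      (Module.Flat R (S ⧸ Ideal.ofList ys) ∧
        Module.FaithfullyFlat R (S ⧸ Ideal.ofList ys) ∧
        IsLocalRing (S ⧸ Ideal.ofList ys) ∧
        IsLocalHom (algebraMap R (S ⧸ Ideal.ofList ys))) ∧
      (∀ (M : Type*) [AddCommGroup M] [Module R M] [Module.Finite R M], Nontrivial M →
        RingTheory.Sequence.IsRegular (S ⊗[R] M) ys) := by
  have hclosed : RingTheory.Sequence.IsWeaklyRegular (S ⊗[R] (R ⧸ maximalIdeal R)) ys := by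
    rw [← (Algebra.TensorProduct.quotIdealMapEquivTensorQuot S
      (maximalIdeal R)).toLinearEquiv.isWeaklyRegular_congr]
    exact (RingTheory.Sequence.isWeaklyRegular_map_algebraMap_iff _ _ ys).mp
      hreg.toIsWeaklyRegular
  have hS : RingTheory.Sequence.IsRegular S ys :=
    .of_isWeaklyRegular_of_mem_maximalIdeal S hys
      (((AlgebraTensorModule.rid R S S).isWeaklyRegular_congr ys).mp
        (isWeaklyRegular_tensor_of_closedFiber hclosed R))
  have hflat : Module.Flat R (S ⧸ Ideal.ofList ys) := by
    have := flat_quotient_ofList_of_closedFiber hclosed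
    exact .of_linearEquiv
      ((Submodule.quotEquivOfEq _ _ (by simp)).restrictScalars R :
        (S ⧸ Ideal.ofList ys) ≃ₗ[R] S ⧸ (Ideal.ofList ys • ⊤ : Submodule S S))
  have : Nontrivial (S ⧸ Ideal.ofList ys) :=
    Ideal.Quotient.nontrivial_iff.mpr fun h ↦ hS.top_ne_smul (by simp [h])
  have hlocal : IsLocalRing (S ⧸ Ideal.ofList ys) :=
    .of_surjective' (Ideal.Quotient.mk _) Ideal.Quotient.mk_surjective
  have hhom : IsLocalHom (algebraMap R (S ⧸ Ideal.ofList ys)) := by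
    have : IsLocalHom (Ideal.Quotient.mk (Ideal.ofList ys)) :=
      .of_surjective _ Ideal.Quotient.mk_surjective
    exact RingHom.isLocalHom_comp (Ideal.Quotient.mk (Ideal.ofList ys)) (algebraMap R S)
  refine ⟨hS, ⟨hflat, .of_flat_of_isLocalHom, hlocal, hhom⟩, fun M _ _ _ _ ↦ ?_⟩
  have : Module.FaithfullyFlat R S := .of_flat_of_isLocalHom
  have := Module.FaithfullyFlat.lTensor_nontrivial R S M
  exact .of_isWeaklyRegular_of_mem_maximalIdeal _ hys
    (isWeaklyRegular_tensor_of_closedFiber hclosed M)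
end

section
/- Let p be a prime and let R be an F-finite Noetherian domain of characteristic p that is F-pure. Then R is weakly normal: every element z of the fraction field Frac(R) with z^p ∈ R lies in R. -/
/-- A ring `R` of prime characteristic `p` is `F`-pure (Frobenius split) if there is an
`R`-linear map `F_* R → R` sending `1` to `1`, i.e. an additive map `φ : R → R` with
`φ (r ^ p * x) = r * φ x` and `φ 1 = 1`. -/
def IsFPure (p : ℕ) (R : Type*) [CommRing R] : Prop :=
  ∃ φ : R →+ R, (∀ r x : R, φ (r ^ p * x) = r * φ x) ∧ φ 1 = 1

/-- A ring `R` of prime characteristic `p` is `F`-finite if `F_* R`, i.e. `R` viewed as an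
`R`-module via the Frobenius, is a finitely generated `R`-module. -/
def IsFFinite (p : ℕ) (R : Type*) [CommRing R] : Prop :=
  ∃ s : Finset R, ∀ x : R, ∃ c : R → R, x = ∑ y ∈ s, c y ^ p * y

/-- An `F`-finite Noetherian `F`-pure domain of characteristic `p` is weakly normal:
every element `z` of the fraction field with `z ^ p ∈ R` lies in `R`. -/
theorem weaklyNormal_of_fPure (R : Type*) [CommRing R] [IsDomain R] [IsNoetherianRing R]
    (p : ℕ) (hp : p.Prime) [CharP R p] (hFF : IsFFinite p R) (hFP : IsFPure p R) :
    ∀ z : FractionRing R, (∃ r : R, algebraMap R (FractionRing R) r = z ^ p) →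
      ∃ r : R, algebraMap R (FractionRing R) r = z := by
  rintro z ⟨r, hr⟩
  obtain ⟨φ, hφ, hφ1⟩ := hFP
  obtain ⟨a, b, hb, rfl⟩ := IsFractionRing.div_surjective (A := R) z
  have hb0 : algebraMap R (FractionRing R) b ≠ 0 :=
    IsFractionRing.to_map_ne_zero_of_mem_nonZeroDivisors hb
  have h : b ^ p * r = a ^ p * 1 := by
    apply IsFractionRing.injective R (FractionRing R)
    rw [div_pow, eq_div_iff (pow_ne_zero p hb0)] at hr
    rw [mul_one, map_mul, map_pow, map_pow, mul_comm, hr]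
  have h' : b * φ r = a := by rw [← hφ, h, hφ, hφ1, mul_one]
  refine ⟨φ r, ?_⟩
  rw [eq_div_iff hb0, ← map_mul, mul_comm, h']
end

section
/- Let p be a prime, let R be an F-finite Noetherian commutative ring of characteristic p, and let 𝔭 be a prime ideal such that the localization R_𝔭 is F-pure. Then there exists f ∈ R ∖ 𝔭 such that for every prime ideal 𝔮 of R with f ∉ 𝔮, the localization R_𝔮 is F-pure; in other words, the F-pure locus {𝔭 ∈ Spec R : R_𝔭 is F-pure} is open in Spec R. -/
/-- The additive group `A` of an `R`-algebra, regarded as an `R`-module along the `p`-th power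
Frobenius of `R`: the scalar `r` acts as multiplication by `r ^ p`. -/
def FrobeniusPushforward (_p : ℕ) (_R A : Type*) : Type _ := A

namespace FrobeniusPushforward

variable (p : ℕ) (R A : Type*) [CommRing R] [ExpChar R p] [CommRing A] [Algebra R A]

instance : AddCommGroup (FrobeniusPushforward p R A) := inferInstanceAs (AddCommGroup A)

instance : Module R (FrobeniusPushforward p R A) :=
  Module.compHom A ((algebraMap R A).comp (frobenius R p))

variable {R A}

/-- The identity map from `A` to its Frobenius pushforward. -/
def of : A ≃+ FrobeniusPushforward p R A := AddEquiv.refl A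

theorem smul_of (r : R) (x : A) :
    r • (of p x : FrobeniusPushforward p R A) = of p (algebraMap R A r ^ p * x) := by
  rw [← map_pow]
  rfl

variable (R A)

/-- The structure map `R → A`, as a linear map between Frobenius pushforwards. -/
def algebraLinearMap : FrobeniusPushforward p R R →ₗ[R] FrobeniusPushforward p R A where
  toFun x := of p (algebraMap R A ((of p).symm x))
  map_add' x y := by simp
  map_smul' r x := by
    obtain ⟨x, rfl⟩ := (of p).surjective x
    simp [smul_of]

theorem algebraLinearMap_of (x : R) :
    algebraLinearMap p R A (of p x) = of p (algebraMap R A x) := rfl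

theorem finite_of_isFFinite (h : IsFFinite p R) :
    Module.Finite R (FrobeniusPushforward p R R) := by
  classical
  obtain ⟨s, hs⟩ := h
  refine ⟨⟨s.image (of p), ?_⟩⟩
  rw [eq_top_iff]
  intro x _
  obtain ⟨x, rfl⟩ := (of p).surjective x
  obtain ⟨c, hc⟩ := hs x
  rw [hc, map_sum]
  refine Submodule.sum_mem _ fun y hy => ?_
  have hy' : of p y ∈ (s.image (of (R := R) p) : Set (FrobeniusPushforward p R R)) :=
    Finset.mem_coe.2 (Finset.mem_image_of_mem _ hy)
  have hmem := Submodule.smul_mem _ (c y) (Submodule.subset_span (R := R) hy')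
  simpa [smul_of] using hmem

/-- Frobenius pushforward commutes with localization. -/
theorem isLocalizedModule (hp : p ≠ 0) (S : Submonoid R) [IsLocalization S A] :
    IsLocalizedModule S (algebraLinearMap p R A) where
  map_units s := by
    rw [Module.End.isUnit_iff]
    have hu : IsUnit (algebraMap R A s ^ p) := (IsLocalization.map_units A s).pow p
    have hb := (of (R := R) (A := A) p).bijective.comp
      ((IsUnit.isUnit_iff_mulLeft_bijective.1 hu).comp (of (R := R) (A := A) p).symm.bijective)
    convert hb using 1
    ext x
    obtain ⟨x, rfl⟩ := (of p).surjective x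
    simp [smul_of]
  surj y := by
    obtain ⟨y, rfl⟩ := (of p).surjective y
    obtain ⟨⟨a, s⟩, has⟩ := IsLocalization.surj S y
    refine ⟨⟨of p (s ^ (p - 1) * a), s⟩, ?_⟩
    obtain ⟨n, rfl⟩ := Nat.exists_eq_succ_of_ne_zero hp
    simp only [Submonoid.smul_def, smul_of, algebraLinearMap_of] at has ⊢
    congr 1
    simp only [Nat.succ_eq_add_one, Nat.add_sub_cancel, map_mul, map_pow, ← has]
    ring
  exists_of_eq {x y} h := by
    obtain ⟨x, rfl⟩ := (of p).surjective x
    obtain ⟨y, rfl⟩ := (of p).surjective y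
    obtain ⟨c, hc⟩ := IsLocalization.exists_of_eq (M := S) ((of p).injective h)
    refine ⟨c, ?_⟩
    obtain ⟨n, rfl⟩ := Nat.exists_eq_succ_of_ne_zero hp
    simp only [Submonoid.smul_def, smul_of, Algebra.algebraMap_self, RingHom.id_apply,
      pow_succ, mul_assoc]
    exact congrArg _ (congrArg _ hc)

variable {R A}

/-- A `p⁻¹`-linear endomorphism of `R` extends to every localization in which the image of `1`
becomes invertible, and yields a Frobenius splitting there. -/
theorem isFPure_of_isUnit (hp : p ≠ 0) (S : Submonoid R) [IsLocalization S A]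
    (ψ : FrobeniusPushforward p R R →ₗ[R] R) (hψ : IsUnit (algebraMap R A (ψ (of p 1)))) :
    IsFPure p A := by
  have := isLocalizedModule p R A hp S
  obtain ⟨u, hu⟩ := hψ
  let L := IsLocalizedModule.map S (algebraLinearMap p R A) (Algebra.linearMap R A) ψ
  refine ⟨(AddMonoidHom.mulLeft (↑u⁻¹ : A)).comp
    (L.toAddMonoidHom.comp (of p : A ≃+ FrobeniusPushforward p R A).toAddMonoidHom), ?_, ?_⟩
  · intro r x
    change (↑u⁻¹ : A) * L (of p (r ^ p * x)) = r * (↑u⁻¹ * L (of p x))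
    obtain ⟨⟨a, s⟩, has⟩ := IsLocalization.surj S r
    have key : algebraMap R A s * L (of p (r ^ p * x)) = algebraMap R A a * L (of p x) := by
      rw [← Algebra.smul_def, ← Algebra.smul_def, ← map_smul L, ← map_smul L, smul_of, smul_of,
        ← has, mul_pow]
      congr 2
      ring
    refine (IsLocalization.map_units A s).mul_left_cancel ?_
    rw [mul_left_comm, key, ← has]
    ring
  · change (↑u⁻¹ : A) * L (of p 1) = 1
    have h1 : L (of p 1) = u := by
      have := IsLocalizedModule.map_apply S (algebraLinearMap p R A) (Algebra.linearMap R A) ψ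
        (of p 1)
      rw [algebraLinearMap_of, map_one] at this
      rw [hu]
      exact this
    rw [h1, Units.inv_mul]

/-- If `A` is a localization of an `F`-finite Noetherian ring `R` at `S` and `A` is `F`-pure, then
some `p⁻¹`-linear endomorphism of `R` sends `1` into `S`. -/
theorem exists_linearMap_of_isFPure [IsNoetherianRing R] (hFF : IsFFinite p R)
    (S : Submonoid R) [IsLocalization S A] (hA : IsFPure p A) :
    ∃ ψ : FrobeniusPushforward p R R →ₗ[R] R, ψ (of p 1) ∈ S := by
  have := finite_of_isFFinite p R hFF
  have : Module.FinitePresentation R (FrobeniusPushforward p R R) :=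
    Module.finitePresentation_of_finite R _
  obtain ⟨φ, hφ, hφ1⟩ := hA
  let l : FrobeniusPushforward p R A →ₗ[R] A :=
    { toFun := fun x => φ ((of p).symm x)
      map_add' := by simp
      map_smul' := fun r x => by
        obtain ⟨x, rfl⟩ := (of p).surjective x
        simp [smul_of, hφ, Algebra.smul_def] }
  obtain ⟨ψ, s, h⟩ := Module.FinitePresentation.exists_lift_of_isLocalizedModule S
    (Algebra.linearMap R A) (l ∘ₗ algebraLinearMap p R A)
  have h1 : algebraMap R A (ψ (of p 1)) = algebraMap R A s := by
    have h2 : algebraMap R A (ψ (of p 1)) = s • φ (algebraMap R A 1) :=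
      LinearMap.congr_fun h (of p 1)
    rw [h2, map_one, hφ1, Submonoid.smul_def, Algebra.smul_def, mul_one]
  obtain ⟨c, hc⟩ := IsLocalization.exists_of_eq (M := S) h1
  refine ⟨(c : R) • ψ, ?_⟩
  rw [LinearMap.smul_apply, smul_eq_mul, hc]
  exact S.mul_mem c.2 s.2

end FrobeniusPushforward


/-- The `F`-pure locus is open: if `R` is an `F`-finite Noetherian ring of prime
characteristic `p` and `R_𝔭` is `F`-pure for a prime `𝔭`, then there is `f ∉ 𝔭` such that
`R_𝔮` is `F`-pure for every prime `𝔮` not containing `f`. -/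
theorem fPure_locus_is_open (R : Type*) [CommRing R] [IsNoetherianRing R]
    (p : ℕ) (hp : p.Prime) [CharP R p] (hFF : IsFFinite p R)
    (𝔭 : Ideal R) [𝔭.IsPrime] (h𝔭 : IsFPure p (Localization.AtPrime 𝔭)) :
    ∃ f : R, f ∉ 𝔭 ∧ ∀ (𝔮 : Ideal R) [𝔮.IsPrime], f ∉ 𝔮 →
      IsFPure p (Localization.AtPrime 𝔮) := by
  have : Fact p.Prime := ⟨hp⟩
  obtain ⟨ψ, hψ⟩ := FrobeniusPushforward.exists_linearMap_of_isFPure p hFF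
    𝔭.primeCompl h𝔭
  refine ⟨_, hψ, fun 𝔮 _ h𝔮 => ?_⟩
  exact FrobeniusPushforward.isFPure_of_isUnit p hp.ne_zero 𝔮.primeCompl ψ
    (IsLocalization.map_units (Localization.AtPrime 𝔮) (⟨_, h𝔮⟩ : 𝔮.primeCompl))
end
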